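/- arXiv:1709.01368 — 4 statements merged into one kernel-verified Lean document; each statement's English description precedes it below -/
import Mathlib

section
/- Let f, g, h be twice continuously differentiable. Let x* be a strict local minimum of the cardinality constrained problem (CCP) such that CC-MFCQ holds at x* and d_xᵀ(∇²f(x*) + Σᵢ λᵢ∇²gᵢ(x*) + Σᵢ μᵢ∇²hᵢ(x*))d_x > 0 for all d_x ∈ C_X(x*) with d_x ≠ 0 and all M-stationary multipliers (λ, μ, γ) of x*. Then there exists r > 0 such that for every sequence (t_k) of positive reals with t_k → 0: for all sufficiently large k the program NLP(t_k) has a KKT point (x^k, y^k) with ‖x^k − x*‖ < r, and for every such sequence of KKT points one has x^k → x*. -/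
open Set Filter Topology

noncomputable section

/-- Number of nonzero components of a vector (the "zero norm"). -/
def card0 {n : ℕ} (x : Fin n → ℝ) : ℕ := {i | x i ≠ 0}.ncard

/-- First directional derivative `∇φ(x)ᵀd`. -/
def D1 {n : ℕ} (φ : (Fin n → ℝ) → ℝ) (x d : Fin n → ℝ) : ℝ := fderiv ℝ φ x d

/-- Second derivative quadratic form `dᵀ∇²φ(x)d`. -/
def D2 {n : ℕ} (φ : (Fin n → ℝ) → ℝ) (x d : Fin n → ℝ) : ℝ :=
  iteratedFDeriv ℝ 2 φ x ![d, d]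

/-- Feasibility for the cardinality constrained problem (CCP):
`g(x) ≤ 0`, `h(x) = 0`, `‖x‖₀ ≤ κ`. -/
def CCPFeasible {n m p : ℕ} (g : (Fin n → ℝ) → Fin m → ℝ) (h : (Fin n → ℝ) → Fin p → ℝ)
    (κ : ℕ) (x : Fin n → ℝ) : Prop :=
  (∀ i, g x i ≤ 0) ∧ (∀ i, h x i = 0) ∧ card0 x ≤ κ

/-- Feasible set `Z` of the continuous reformulation. -/
def ZSet {n m p : ℕ} (g : (Fin n → ℝ) → Fin m → ℝ) (h : (Fin n → ℝ) → Fin p → ℝ)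
    (κ : ℕ) : Set ((Fin n → ℝ) × (Fin n → ℝ)) :=
  {z | (∀ i, g z.1 i ≤ 0) ∧ (∀ i, h z.1 i = 0) ∧ (∀ i, 0 ≤ z.2 i) ∧ (∀ i, z.2 i ≤ 1) ∧
    ((n : ℝ) - (κ : ℝ) ≤ ∑ i, z.2 i) ∧ ∀ i, z.1 i * z.2 i = 0}

/-- `(lam, mu, gam)` is an M-stationary multiplier at `x`. -/
def IsMMult {n m p : ℕ} (f : (Fin n → ℝ) → ℝ) (g : (Fin n → ℝ) → Fin m → ℝ)
    (h : (Fin n → ℝ) → Fin p → ℝ) (x : Fin n → ℝ)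
    (lam : Fin m → ℝ) (mu : Fin p → ℝ) (gam : Fin n → ℝ) : Prop :=
  (∀ d, D1 f x d + ∑ i, lam i * D1 (fun x' => g x' i) x d
      + ∑ i, mu i * D1 (fun x' => h x' i) x d + ∑ i, gam i * d i = 0) ∧
  (∀ i, 0 ≤ lam i) ∧ (∀ i, lam i * g x i = 0) ∧ (∀ i, x i ≠ 0 → gam i = 0)

/-- `(lam, mu, gam)` is an S-stationary multiplier at `(x, y)`. -/
def IsSMult {n m p : ℕ} (f : (Fin n → ℝ) → ℝ) (g : (Fin n → ℝ) → Fin m → ℝ)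
    (h : (Fin n → ℝ) → Fin p → ℝ) (x y : Fin n → ℝ)
    (lam : Fin m → ℝ) (mu : Fin p → ℝ) (gam : Fin n → ℝ) : Prop :=
  IsMMult f g h x lam mu gam ∧ ∀ i, x i = 0 → y i = 0 → gam i = 0

/-- `z` is an M-stationary point of the continuous reformulation. -/
def MStationary {n m p : ℕ} (f : (Fin n → ℝ) → ℝ) (g : (Fin n → ℝ) → Fin m → ℝ)
    (h : (Fin n → ℝ) → Fin p → ℝ) (κ : ℕ) (z : (Fin n → ℝ) × (Fin n → ℝ)) : Prop :=
  z ∈ ZSet g h κ ∧ ∃ lam mu gam, IsMMult f g h z.1 lam mu gam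

/-- `z` is an S-stationary point of the continuous reformulation. -/
def SStationary {n m p : ℕ} (f : (Fin n → ℝ) → ℝ) (g : (Fin n → ℝ) → Fin m → ℝ)
    (h : (Fin n → ℝ) → Fin p → ℝ) (κ : ℕ) (z : (Fin n → ℝ) × (Fin n → ℝ)) : Prop :=
  z ∈ ZSet g h κ ∧ ∃ lam mu gam, IsSMult f g h z.1 z.2 lam mu gam

/-- CC-LICQ at `x`: the active gradients `∇gᵢ(x)` (`gᵢ(x) = 0`), all `∇hᵢ(x)`,
and the unit vectors `eᵢ` (`xᵢ = 0`) are linearly independent. -/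
def CCLICQ {n m p : ℕ} (g : (Fin n → ℝ) → Fin m → ℝ) (h : (Fin n → ℝ) → Fin p → ℝ)
    (x : Fin n → ℝ) : Prop :=
  ∀ (lam : Fin m → ℝ) (mu : Fin p → ℝ) (gam : Fin n → ℝ),
    (∀ i, g x i ≠ 0 → lam i = 0) → (∀ i, x i ≠ 0 → gam i = 0) →
    (∀ d, ∑ i, lam i * D1 (fun x' => g x' i) x d
        + ∑ i, mu i * D1 (fun x' => h x' i) x d + ∑ i, gam i * d i = 0) →
    lam = 0 ∧ mu = 0 ∧ gam = 0

/-- CC-MFCQ at `x`: the active gradients `∇gᵢ(x)` together with all `∇hᵢ(x)` and the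
unit vectors `eᵢ` (`xᵢ = 0`) are positively linearly independent. -/
def CCMFCQ {n m p : ℕ} (g : (Fin n → ℝ) → Fin m → ℝ) (h : (Fin n → ℝ) → Fin p → ℝ)
    (x : Fin n → ℝ) : Prop :=
  ∀ (lam : Fin m → ℝ) (mu : Fin p → ℝ) (gam : Fin n → ℝ),
    (∀ i, 0 ≤ lam i) → (∀ i, g x i ≠ 0 → lam i = 0) → (∀ i, x i ≠ 0 → gam i = 0) →
    (∀ d, ∑ i, lam i * D1 (fun x' => g x' i) x d
        + ∑ i, mu i * D1 (fun x' => h x' i) x d + ∑ i, gam i * d i = 0) →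
    lam = 0 ∧ mu = 0 ∧ gam = 0

/-- The linear combination `Σ lamᵢ ∇gᵢ(x) + Σ muᵢ ∇hᵢ(x) + Σ gamᵢ eᵢ` vanishes. -/
def CombZero {n m p : ℕ} (g : (Fin n → ℝ) → Fin m → ℝ) (h : (Fin n → ℝ) → Fin p → ℝ)
    (lam : Fin m → ℝ) (mu : Fin p → ℝ) (gam : Fin n → ℝ) (x : Fin n → ℝ) : Prop :=
  ∀ d, ∑ i, lam i * D1 (fun x' => g x' i) x d
      + ∑ i, mu i * D1 (fun x' => h x' i) x d + ∑ i, gam i * d i = 0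

/-- CC-CPLD at `x`: whenever gradients indexed by subsets of the active sets are
positively linearly dependent at `x`, they remain linearly dependent nearby. -/
def CCCPLD {n m p : ℕ} (g : (Fin n → ℝ) → Fin m → ℝ) (h : (Fin n → ℝ) → Fin p → ℝ)
    (x : Fin n → ℝ) : Prop :=
  ∀ (I1 : Finset (Fin m)) (I2 : Finset (Fin p)) (I3 : Finset (Fin n)),
    (∀ i ∈ I1, g x i = 0) → (∀ i ∈ I3, x i = 0) →
    (∃ lam mu gam, (∀ i, 0 ≤ lam i) ∧ (∀ i, i ∉ I1 → lam i = 0) ∧ (∀ i, i ∉ I2 → mu i = 0) ∧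
      (∀ i, i ∉ I3 → gam i = 0) ∧ ¬(lam = 0 ∧ mu = 0 ∧ gam = 0) ∧ CombZero g h lam mu gam x) →
    ∀ᶠ x' in nhds x, ∃ lam mu gam, (∀ i, i ∉ I1 → lam i = 0) ∧ (∀ i, i ∉ I2 → mu i = 0) ∧
      (∀ i, i ∉ I3 → gam i = 0) ∧ ¬(lam = 0 ∧ mu = 0 ∧ gam = 0) ∧ CombZero g h lam mu gam x'

/-- The CC-linearisation cone `L_Z(x, y)` (as a predicate on `(dx, dy)`). -/
def LinCone {n m p : ℕ} (g : (Fin n → ℝ) → Fin m → ℝ) (h : (Fin n → ℝ) → Fin p → ℝ)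
    (κ : ℕ) (x y dx dy : Fin n → ℝ) : Prop :=
  (∀ i, g x i = 0 → D1 (fun x' => g x' i) x dx ≤ 0) ∧
  (∀ i, D1 (fun x' => h x' i) x dx = 0) ∧
  ((∑ i, y i = (n : ℝ) - (κ : ℝ)) → 0 ≤ ∑ i, dy i) ∧
  (∀ i, x i ≠ 0 → y i = 0 → dy i = 0) ∧
  (∀ i, x i = 0 → y i = 0 → 0 ≤ dy i) ∧
  (∀ i, x i = 0 → y i = 1 → dy i ≤ 0) ∧
  (∀ i, x i = 0 → 0 < y i → dx i = 0) ∧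
  (∀ i, x i = 0 → y i = 0 → dx i * dy i = 0)

/-- The CC-critical cone `C_Z(x, y)`. -/
def CritCone {n m p : ℕ} (f : (Fin n → ℝ) → ℝ) (g : (Fin n → ℝ) → Fin m → ℝ)
    (h : (Fin n → ℝ) → Fin p → ℝ) (κ : ℕ) (x y dx dy : Fin n → ℝ) : Prop :=
  LinCone g h κ x y dx dy ∧ D1 f x dx ≤ 0

/-- The critical cone `C_X(x)` for the original cardinality constrained problem. -/
def CritConeX {n m p : ℕ} (f : (Fin n → ℝ) → ℝ) (g : (Fin n → ℝ) → Fin m → ℝ)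
    (h : (Fin n → ℝ) → Fin p → ℝ) (κ : ℕ) (x dx : Fin n → ℝ) : Prop :=
  (∀ i, g x i = 0 → D1 (fun x' => g x' i) x dx ≤ 0) ∧
  (∀ i, D1 (fun x' => h x' i) x dx = 0) ∧
  (n - κ ≤ {i | x i = 0 ∧ dx i = 0}.ncard) ∧
  D1 f x dx ≤ 0

/-- `x` is a local minimum of the cardinality constrained problem. -/
def LocalMinCCP {n m p : ℕ} (f : (Fin n → ℝ) → ℝ) (g : (Fin n → ℝ) → Fin m → ℝ)
    (h : (Fin n → ℝ) → Fin p → ℝ) (κ : ℕ) (x : Fin n → ℝ) : Prop :=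
  CCPFeasible g h κ x ∧ ∃ r > (0 : ℝ), ∀ x', CCPFeasible g h κ x' → dist x' x < r → f x ≤ f x'

/-- `x` is a strict local minimum of the cardinality constrained problem. -/
def StrictLocalMinCCP {n m p : ℕ} (f : (Fin n → ℝ) → ℝ) (g : (Fin n → ℝ) → Fin m → ℝ)
    (h : (Fin n → ℝ) → Fin p → ℝ) (κ : ℕ) (x : Fin n → ℝ) : Prop :=
  CCPFeasible g h κ x ∧
    ∃ r > (0 : ℝ), ∀ x', CCPFeasible g h κ x' → dist x' x < r → x' ≠ x → f x < f x'

/-- `z` is a local minimum of the continuous reformulation. -/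
def LocalMinZ {n m p : ℕ} (f : (Fin n → ℝ) → ℝ) (g : (Fin n → ℝ) → Fin m → ℝ)
    (h : (Fin n → ℝ) → Fin p → ℝ) (κ : ℕ) (z : (Fin n → ℝ) × (Fin n → ℝ)) : Prop :=
  z ∈ ZSet g h κ ∧ ∃ r > (0 : ℝ), ∀ z' ∈ ZSet g h κ, dist z' z < r → f z.1 ≤ f z'.1

/-- `z` is a strict local minimum with respect to `x` of the continuous reformulation. -/
def StrictLocalMinX {n m p : ℕ} (f : (Fin n → ℝ) → ℝ) (g : (Fin n → ℝ) → Fin m → ℝ)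
    (h : (Fin n → ℝ) → Fin p → ℝ) (κ : ℕ) (z : (Fin n → ℝ) × (Fin n → ℝ)) : Prop :=
  z ∈ ZSet g h κ ∧
    ∃ r > (0 : ℝ), ∀ z' ∈ ZSet g h κ, dist z' z < r → z'.1 ≠ z.1 → f z.1 < f z'.1

/-- Feasible set `Z(t)` of the Scholtes-type regularized program NLP(t). -/
def ZReg {n m p : ℕ} (g : (Fin n → ℝ) → Fin m → ℝ) (h : (Fin n → ℝ) → Fin p → ℝ)
    (κ : ℕ) (t : ℝ) : Set ((Fin n → ℝ) × (Fin n → ℝ)) :=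
  {z | (∀ i, g z.1 i ≤ 0) ∧ (∀ i, h z.1 i = 0) ∧ (∀ i, 0 ≤ z.2 i) ∧ (∀ i, z.2 i ≤ 1) ∧
    ((n : ℝ) - (κ : ℝ) ≤ ∑ i, z.2 i) ∧ (∀ i, z.1 i * z.2 i ≤ t) ∧ ∀ i, -t ≤ z.1 i * z.2 i}

/-- `z` is a local minimum of the regularized program NLP(t). -/
def LocalMinReg {n m p : ℕ} (f : (Fin n → ℝ) → ℝ) (g : (Fin n → ℝ) → Fin m → ℝ)
    (h : (Fin n → ℝ) → Fin p → ℝ) (κ : ℕ) (t : ℝ) (z : (Fin n → ℝ) × (Fin n → ℝ)) : Prop :=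
  z ∈ ZReg g h κ t ∧ ∃ r > (0 : ℝ), ∀ z' ∈ ZReg g h κ t, dist z' z < r → f z.1 ≤ f z'.1

/-- `z` is a KKT point of the regularized program NLP(t). -/
def KKTReg {n m p : ℕ} (f : (Fin n → ℝ) → ℝ) (g : (Fin n → ℝ) → Fin m → ℝ)
    (h : (Fin n → ℝ) → Fin p → ℝ) (κ : ℕ) (t : ℝ) (z : (Fin n → ℝ) × (Fin n → ℝ)) : Prop :=
  z ∈ ZReg g h κ t ∧
  ∃ (lam : Fin m → ℝ) (mu : Fin p → ℝ) (nu0 nu1 : Fin n → ℝ) (rho : ℝ) (dpl dmi : Fin n → ℝ),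
    (∀ d : Fin n → ℝ, D1 f z.1 d + ∑ i, lam i * D1 (fun x' => g x' i) z.1 d
        + ∑ i, mu i * D1 (fun x' => h x' i) z.1 d
        + ∑ i, (dpl i - dmi i) * z.2 i * d i = 0) ∧
    (∀ i, -nu0 i + nu1 i - rho + (dpl i - dmi i) * z.1 i = 0) ∧
    (∀ i, 0 ≤ lam i) ∧ (∀ i, 0 ≤ nu0 i) ∧ (∀ i, 0 ≤ nu1 i) ∧ 0 ≤ rho ∧
    (∀ i, 0 ≤ dpl i) ∧ (∀ i, 0 ≤ dmi i) ∧
    (∀ i, lam i * g z.1 i = 0) ∧ (∀ i, nu0 i * z.2 i = 0) ∧ (∀ i, nu1 i * (z.2 i - 1) = 0) ∧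
    rho * (∑ i, z.2 i - ((n : ℝ) - (κ : ℝ))) = 0 ∧
    (∀ i, dpl i * (z.1 i * z.2 i - t) = 0) ∧ (∀ i, dmi i * (z.1 i * z.2 i + t) = 0)

/-- Standard MFCQ for the regularized program NLP(t) at a feasible point `z`. -/
def MFCQReg {n m p : ℕ} (g : (Fin n → ℝ) → Fin m → ℝ) (h : (Fin n → ℝ) → Fin p → ℝ)
    (κ : ℕ) (t : ℝ) (z : (Fin n → ℝ) × (Fin n → ℝ)) : Prop :=
  (∀ mu : Fin p → ℝ, (∀ d, ∑ i, mu i * D1 (fun x' => h x' i) z.1 d = 0) → mu = 0) ∧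
  ∃ dx dy : Fin n → ℝ,
    (∀ i, D1 (fun x' => h x' i) z.1 dx = 0) ∧
    (∀ i, g z.1 i = 0 → D1 (fun x' => g x' i) z.1 dx < 0) ∧
    (∀ i, z.2 i = 0 → 0 < dy i) ∧
    (∀ i, z.2 i = 1 → dy i < 0) ∧
    (∑ i, z.2 i = (n : ℝ) - (κ : ℝ) → 0 < ∑ i, dy i) ∧
    (∀ i, z.1 i * z.2 i = t → z.2 i * dx i + z.1 i * dy i < 0) ∧
    (∀ i, z.1 i * z.2 i = -t → 0 < z.2 i * dx i + z.1 i * dy i)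

/-! ### Ultrafilter compactness -/

lemma exists_tendsto_of_eventually_mem {α X : Type*} [TopologicalSpace X] (U : Ultrafilter α)
    {K : Set X} (hK : IsCompact K) {u : α → X} (hu : ∀ᶠ a in U, u a ∈ K) :
    ∃ x ∈ K, Tendsto u U (𝓝 x) := by
  obtain ⟨x, hx, h⟩ := hK.ultrafilter_le_nhds (U.map u) (le_principal_iff.2 hu)
  exact ⟨x, hx, h⟩

lemma exists_tendsto_of_norm_le {α E : Type*} [NormedAddCommGroup E] [ProperSpace E]
    (U : Ultrafilter α) {u : α → E} {C : ℝ} (hu : ∀ᶠ a in U, ‖u a‖ ≤ C) :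
    ∃ x, Tendsto u U (𝓝 x) := by
  obtain ⟨x, -, h⟩ := exists_tendsto_of_eventually_mem U (isCompact_closedBall (0 : E) C)
    (u := u) (by simpa using hu)
  exact ⟨x, h⟩

/-! ### Fritz John conditions -/

lemma hasDerivAt_max_zero_sq (u : ℝ) : HasDerivAt (fun v : ℝ => max v 0 ^ 2) (2 * max u 0) u := by
  rcases lt_trichotomy u 0 with hu | rfl | hu
  · have : (fun v : ℝ => max v 0 ^ 2) =ᶠ[𝓝 u] fun _ => 0 := by
      filter_upwards [eventually_lt_nhds hu] with v hv
      simp [max_eq_right hv.le]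
    rw [max_eq_right hu.le, mul_zero]
    exact (hasDerivAt_const u (0 : ℝ)).congr_of_eventuallyEq this
  · rw [hasDerivAt_iff_isLittleO_nhds_zero]
    have h2 : (fun v : ℝ => v ^ 2) =o[𝓝 0] fun v : ℝ => v := by
      simpa using Asymptotics.isLittleO_pow_pow (𝕜 := ℝ) (one_lt_two)
    refine Asymptotics.IsBigO.trans_isLittleO (Asymptotics.IsBigO.of_bound 1 ?_) h2
    refine Eventually.of_forall fun v => ?_
    rcases le_total v 0 with hv | hv <;> simp [hv, sq_nonneg]
  · have : (fun v : ℝ => max v 0 ^ 2) =ᶠ[𝓝 u] fun v => v ^ 2 := by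
      filter_upwards [eventually_gt_nhds hu] with v hv
      simp [max_eq_left hv.le]
    rw [max_eq_left hu.le]
    have h := hasDerivAt_pow 2 u
    simp only [Nat.cast_ofNat, Nat.add_one_sub_one, pow_one] at h
    exact h.congr_of_eventuallyEq this

lemma exists_smooth_gauge (E : Type*) [NormedAddCommGroup E] [NormedSpace ℝ E]
    [FiniteDimensional ℝ E] (z : E) :
    ∃ q : E → ℝ, ContDiff ℝ 1 q ∧ (∀ w, 0 ≤ q w) ∧ (∀ w, q w = 0 ↔ w = z) := by
  refine ⟨fun w => ‖toEuclidean (w - z)‖ ^ 2, ?_, fun w => by positivity, fun w => ?_⟩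
  · exact (contDiff_norm_sq ℝ).comp (toEuclidean.contDiff.comp (contDiff_id.sub contDiff_const))
  · simp [sub_eq_zero]

theorem fritz_john {E ι ι' : Type*} [NormedAddCommGroup E] [NormedSpace ℝ E]
    [FiniteDimensional ℝ E] [Fintype ι] [Fintype ι'] (F : E → ℝ) (G : ι → E → ℝ) (H : ι' → E → ℝ)
    (hF : ContDiff ℝ 1 F) (hG : ∀ i, ContDiff ℝ 1 (G i)) (hH : ∀ j, ContDiff ℝ 1 (H j)) (z : E)
    (hGz : ∀ i, G i z ≤ 0) (hHz : ∀ j, H j z = 0)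
    (hmin : IsLocalMinOn F {w | (∀ i, G i w ≤ 0) ∧ ∀ j, H j w = 0} z) :
    ∃ (s : ℝ) (lam : ι → ℝ) (mu : ι' → ℝ), 0 ≤ s ∧ (∀ i, 0 ≤ lam i) ∧
      ¬(s = 0 ∧ lam = 0 ∧ mu = 0) ∧ (∀ i, lam i * G i z = 0) ∧
      ∀ d, s * fderiv ℝ F z d + ∑ i, lam i * fderiv ℝ (G i) z d
        + ∑ j, mu j * fderiv ℝ (H j) z d = 0 := by
  have : ProperSpace E := FiniteDimensional.proper ℝ E
  obtain ⟨q, hq, hq0, hqz⟩ := exists_smooth_gauge E z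
  obtain ⟨ε, hε, hball⟩ : ∃ ε > 0, ∀ w ∈ Metric.closedBall z ε, (∀ i, G i w ≤ 0) →
      (∀ j, H j w = 0) → F z ≤ F w := by
    have h1 : ∀ᶠ w in 𝓝 z, (∀ i, G i w ≤ 0) → (∀ j, H j w = 0) → F z ≤ F w := by
      have := eventually_nhdsWithin_iff.1 hmin
      filter_upwards [this] with w hw h1 h2 using hw ⟨h1, h2⟩
    obtain ⟨ε, hε, h⟩ := Metric.nhds_basis_closedBall.eventually_iff.1 h1
    exact ⟨ε, hε, fun w hw => h hw⟩
  set P : E → ℝ := fun w => ∑ i, max (G i w) 0 ^ 2 + ∑ j, H j w ^ 2 with hP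
  have hPc : Continuous P := by
    have := fun i => (hG i).continuous
    have := fun j => (hH j).continuous
    fun_prop
  have hP0 : ∀ w, 0 ≤ P w := fun w => by positivity
  have hPz : P z = 0 := by simp [hP, hHz, hGz]
  have hex : ∀ k : ℕ, ∃ w ∈ Metric.closedBall z ε, IsMinOn (fun w => F w + q w + k * P w)
      (Metric.closedBall z ε) w := fun k =>
    (isCompact_closedBall z ε).exists_isMinOn ⟨z, Metric.mem_closedBall_self hε.le⟩
      (((hF.continuous.add hq.continuous).add (continuous_const.mul hPc)).continuousOn)
  choose w hwb hwmin using hex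
  have hle : ∀ k, F (w k) + q (w k) + k * P (w k) ≤ F z := fun k => by
    have := hwmin k (Metric.mem_closedBall_self hε.le)
    simpa [hPz, (hqz z).2 rfl] using this
  let U : Ultrafilter ℕ := Filter.hyperfilter ℕ
  have hU : (U : Filter ℕ) ≤ atTop := Nat.hyperfilter_le_atTop
  obtain ⟨w', hw'b, hw'⟩ := exists_tendsto_of_eventually_mem U (isCompact_closedBall z ε)
    (u := w) (Eventually.of_forall hwb)
  have hPw' : P w' = 0 := by
    obtain ⟨v, -, hv⟩ := (isCompact_closedBall z ε).exists_isMinOn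
      ⟨z, Metric.mem_closedBall_self hε.le⟩ hF.continuous.continuousOn
    have hb : ∀ k : ℕ, k * P (w k) ≤ F z - F v := fun k => by
      have h1 := hle k
      have h2 : F v ≤ F (w k) := hv (hwb k)
      have h3 := hq0 (w k)
      linarith
    have h1 : Tendsto (fun k : ℕ => (F z - F v) / k) U (𝓝 0) :=
      (tendsto_const_div_atTop_nhds_zero_nat _).mono_left hU
    have h2 : Tendsto (fun k => P (w k)) U (𝓝 (P w')) := (hPc.tendsto w').comp hw'
    refine le_antisymm (le_of_tendsto_of_tendsto h2 h1 ?_) (hP0 _)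
    filter_upwards [hU (eventually_gt_atTop 0)] with k hk
    rw [le_div_iff₀ (by exact_mod_cast hk), mul_comm]
    exact hb k
  have hw'z : w' = z := by
    have hS1 : ∀ i, 0 ≤ max (G i w') 0 ^ 2 := fun i => by positivity
    have hS2 : ∀ j, 0 ≤ H j w' ^ 2 := fun i => by positivity
    have hadd := (add_eq_zero_iff_of_nonneg (Finset.sum_nonneg fun i _ => hS1 i)
      (Finset.sum_nonneg fun j _ => hS2 j)).1 hPw'
    have hg : ∀ i, G i w' ≤ 0 := fun i => by
      have := (Finset.sum_eq_zero_iff_of_nonneg fun i _ => hS1 i).1 hadd.1 i (Finset.mem_univ i)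
      simpa using this
    have hh : ∀ j, H j w' = 0 := fun j => by
      have := (Finset.sum_eq_zero_iff_of_nonneg fun i _ => hS2 i).1 hadd.2 j (Finset.mem_univ j)
      simpa using this
    have h1 : F w' + q w' ≤ F z := by
      refine le_of_tendsto (((hF.continuous.tendsto w').comp hw').add
        ((hq.continuous.tendsto w').comp hw')) (Eventually.of_forall fun k => ?_)
      have := hle k
      have := hP0 (w k)
      simp only [Function.comp]
      nlinarith [(Nat.cast_nonneg k : (0 : ℝ) ≤ k)]
    have h2 := hball w' hw'b hg hh
    exact (hqz w').1 (le_antisymm (by linarith) (hq0 _))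
  subst hw'z
  have hder : ∀ᶠ k in U, ∀ d, fderiv ℝ F (w k) d + fderiv ℝ q (w k) d
      + ∑ i, (k * (2 * max (G i (w k)) 0)) * fderiv ℝ (G i) (w k) d
      + ∑ j, (k * (2 * H j (w k))) * fderiv ℝ (H j) (w k) d = 0 := by
    filter_upwards [hw' (Metric.ball_mem_nhds w' hε)] with k hk d
    have hloc : IsLocalMin (fun w => F w + q w + k * P w) (w k) :=
      (hwmin k).isLocalMin (mem_of_superset (Metric.isOpen_ball.mem_nhds hk)
        Metric.ball_subset_closedBall)
    have hd : ∀ {φ : E → ℝ}, ContDiff ℝ 1 φ → HasFDerivAt φ (fderiv ℝ φ (w k)) (w k) :=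
      fun hφ => (hφ.differentiable one_ne_zero _).hasFDerivAt
    have hPd : HasFDerivAt P (∑ i, (2 * max (G i (w k)) 0) • fderiv ℝ (G i) (w k)
        + ∑ j, (2 * H j (w k)) • fderiv ℝ (H j) (w k)) (w k) := by
      refine HasFDerivAt.add (HasFDerivAt.fun_sum fun i _ => ?_) (HasFDerivAt.fun_sum fun j _ => ?_)
      · exact (hasDerivAt_max_zero_sq _).comp_hasFDerivAt (w k) (hd (hG i))
      · have := (hd (hH j)).pow 2
        simpa using this
    have h0 := hloc.hasFDerivAt_eq_zero (((hd hF).add (hd hq)).add (hPd.const_mul (k : ℝ)))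
    have h1 := congrArg (fun L => L d) h0
    simp only [_root_.add_apply, _root_.smul_apply,
      _root_.sum_apply, smul_eq_mul, mul_add, Finset.mul_sum,
      _root_.zero_apply] at h1
    simp only [mul_assoc] at h1 ⊢
    linarith
  let M : ℕ → ℝ × (ι → ℝ) × (ι' → ℝ) := fun k =>
    (1, fun i => k * (2 * max (G i (w k)) 0), fun j => k * (2 * H j (w k)))
  have hM1 : ∀ k, 1 ≤ ‖M k‖ := fun k => by simp [M]
  have hM0 : ∀ k, 0 < ‖M k‖ := fun k => zero_lt_one.trans_le (hM1 k)
  obtain ⟨N, hN, hNt⟩ := exists_tendsto_of_eventually_mem U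
    (isCompact_sphere (0 : ℝ × (ι → ℝ) × (ι' → ℝ)) 1) (u := fun k => ‖M k‖⁻¹ • M k)
    (Eventually.of_forall fun k => by simp [norm_smul, (hM0 k).ne'])
  have hs : Tendsto (fun k => ‖M k‖⁻¹) U (𝓝 N.1) := by
    simpa [M, Function.comp_def] using (continuous_fst.tendsto N).comp hNt
  have hl : ∀ i, Tendsto (fun k => ‖M k‖⁻¹ * (k * (2 * max (G i (w k)) 0))) U (𝓝 (N.2.1 i)) :=
    fun i => (((continuous_apply i).comp (continuous_fst.comp continuous_snd)).tendsto N).comp hNt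
  have hm : ∀ j, Tendsto (fun k => ‖M k‖⁻¹ * (k * (2 * H j (w k)))) U (𝓝 (N.2.2 j)) :=
    fun j => (((continuous_apply j).comp (continuous_snd.comp continuous_snd)).tendsto N).comp hNt
  have hD : ∀ {φ : E → ℝ}, ContDiff ℝ 1 φ → ∀ d,
      Tendsto (fun k => fderiv ℝ φ (w k) d) U (𝓝 (fderiv ℝ φ w' d)) := fun hφ d =>
    (((hφ.continuous_fderiv one_ne_zero).clm_apply continuous_const).tendsto w').comp hw'
  have hq' : fderiv ℝ q w' = 0 := by
    refine IsLocalMin.fderiv_eq_zero (Eventually.of_forall fun v => ?_)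
    simpa [(hqz w').2 rfl] using hq0 v
  refine ⟨N.1, N.2.1, N.2.2, ge_of_tendsto hs (Eventually.of_forall fun k => by positivity),
    fun i => ge_of_tendsto (hl i) (Eventually.of_forall fun k => by positivity), ?_, fun i => ?_,
    fun d => ?_⟩
  · rintro ⟨h1, h2, h3⟩
    have : N = 0 := Prod.ext h1 (Prod.ext h2 h3)
    simp [this] at hN
  · rcases (hGz i).lt_or_eq with hi | hi
    · have : N.2.1 i = 0 := by
        refine tendsto_nhds_unique (hl i) (tendsto_const_nhds.congr' ?_)
        filter_upwards [(((hG i).continuous.tendsto w').comp hw').eventually (gt_mem_nhds hi)]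
          with k hk
        simp only [Function.comp] at hk
        simp [max_eq_right hk.le]
      simp [this]
    · simp [hi]
  · have hlim := (((hs.mul (hD hF d)).add (hs.mul (hD hq d))).add
      (tendsto_finsetSum Finset.univ fun i _ => (hl i).mul (hD (hG i) d))).add
      (tendsto_finsetSum Finset.univ fun j _ => (hm j).mul (hD (hH j) d))
    rw [hq', _root_.zero_apply, mul_zero, add_zero] at hlim
    refine tendsto_nhds_unique hlim (tendsto_const_nhds.congr' ?_)
    filter_upwards [hder] with k hk
    have := congrArg (fun v => ‖M k‖⁻¹ * v) (hk d)
    simp only [mul_add, Finset.mul_sum, mul_zero] at this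
    simp only [mul_assoc] at this ⊢
    exact this.symm

/-! ### Uniform multiplier bounds -/

lemma D1_eq_fderiv {n : ℕ} (φ : (Fin n → ℝ) → ℝ) (x d : Fin n → ℝ) :
    D1 φ x d = fderiv ℝ φ x d := rfl

/-- The functional `Σ lamᵢ ∇gᵢ(x) + Σ muᵢ ∇hᵢ(x) + Σ gamᵢ eᵢ` for `M = (lam, mu, gam)`. -/
def multFunctional {n m p : ℕ} (g : (Fin n → ℝ) → Fin m → ℝ) (h : (Fin n → ℝ) → Fin p → ℝ)
    (x : Fin n → ℝ) (M : (Fin m → ℝ) × (Fin p → ℝ) × (Fin n → ℝ)) : (Fin n → ℝ) →L[ℝ] ℝ :=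
  ∑ i, M.1 i • fderiv ℝ (fun x' => g x' i) x + ∑ i, M.2.1 i • fderiv ℝ (fun x' => h x' i) x
    + ∑ i, M.2.2 i • ContinuousLinearMap.proj i

section

variable {n m p : ℕ} {f : (Fin n → ℝ) → ℝ} {g : (Fin n → ℝ) → Fin m → ℝ}
  {h : (Fin n → ℝ) → Fin p → ℝ}

lemma multFunctional_apply (x : Fin n → ℝ) (M : (Fin m → ℝ) × (Fin p → ℝ) × (Fin n → ℝ))
    (d : Fin n → ℝ) :
    multFunctional g h x M d = ∑ i, M.1 i * D1 (fun x' => g x' i) x d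
      + ∑ i, M.2.1 i * D1 (fun x' => h x' i) x d + ∑ i, M.2.2 i * d i := by
  simp [multFunctional, D1]

lemma multFunctional_smul (x : Fin n → ℝ) (c : ℝ)
    (M : (Fin m → ℝ) × (Fin p → ℝ) × (Fin n → ℝ)) :
    multFunctional g h x (c • M) = c • multFunctional g h x M := by
  simp [multFunctional, Finset.smul_sum, smul_smul]

lemma continuous_multFunctional (hg : ∀ i, ContDiff ℝ 2 (fun x => g x i))
    (hh : ∀ i, ContDiff ℝ 2 (fun x => h x i)) :
    Continuous fun q : (Fin n → ℝ) × ((Fin m → ℝ) × (Fin p → ℝ) × (Fin n → ℝ)) =>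
      multFunctional g h q.1 q.2 := by
  have h1 := fun i => (hg i).continuous_fderiv two_ne_zero
  have h2 := fun i => (hh i).continuous_fderiv two_ne_zero
  unfold multFunctional
  fun_prop

/-- Quantitative form of CC-MFCQ, uniform in a neighbourhood of the reference point. -/
lemma exists_multiplier_bound (hg : ∀ i, ContDiff ℝ 2 (fun x => g x i))
    (hh : ∀ i, ContDiff ℝ 2 (fun x => h x i)) {a : Fin n → ℝ} (ha : CCMFCQ g h a) :
    ∃ c > (0 : ℝ), ∀ᶠ x in 𝓝 a, ∀ M : (Fin m → ℝ) × (Fin p → ℝ) × (Fin n → ℝ),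
      (∀ i, 0 ≤ M.1 i) → (∀ i, M.1 i * g x i = 0) →
      c * ‖M‖ ≤ ‖multFunctional g h x M‖ + ∑ i, a i ^ 2 * |M.2.2 i| := by
  set Ψ : (Fin n → ℝ) × ((Fin m → ℝ) × (Fin p → ℝ) × (Fin n → ℝ)) → ℝ :=
    fun q => ‖multFunctional g h q.1 q.2‖ + ∑ i, a i ^ 2 * |q.2.2.2 i| with hΨ
  have hΨc : Continuous Ψ := by
    have := continuous_multFunctional hg hh
    fun_prop
  set S : Set ((Fin m → ℝ) × (Fin p → ℝ) × (Fin n → ℝ)) :=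
    {M | ‖M‖ = 1 ∧ (∀ i, 0 ≤ M.1 i) ∧ ∀ i, M.1 i * g a i = 0} with hS
  have hSc : IsCompact S := by
    refine (isCompact_sphere (0 : (Fin m → ℝ) × (Fin p → ℝ) × (Fin n → ℝ)) 1).of_isClosed_subset
      ?_ fun M hM => by simpa using hM.1
    simp only [hS, Set.ofPred_and, Set.ofPred_forall]
    refine (isClosed_eq continuous_norm continuous_const).inter
      ((isClosed_iInter fun i => isClosed_le continuous_const (by fun_prop)).inter
      (isClosed_iInter fun i => isClosed_eq (by fun_prop) continuous_const))
  have hpos : ∀ M ∈ S, 0 < Ψ (a, M) := by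
    intro M hM
    have h0 : 0 ≤ ∑ i, a i ^ 2 * |M.2.2 i| := Finset.sum_nonneg fun i _ => by positivity
    refine lt_of_le_of_ne (add_nonneg (norm_nonneg _) h0) fun h1 => ?_
    have h2 := (add_eq_zero_iff_of_nonneg (norm_nonneg _) h0).1 h1.symm
    have h3 : M.1 = 0 ∧ M.2.1 = 0 ∧ M.2.2 = 0 := by
      refine ha _ _ _ hM.2.1 (fun i hi => ?_) (fun i hi => ?_) fun d => ?_
      · simpa [hi] using hM.2.2 i
      · have := (Finset.sum_eq_zero_iff_of_nonneg fun i _ => by positivity).1 h2.2 i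
          (Finset.mem_univ i)
        simpa [hi] using this
      · rw [← multFunctional_apply, norm_eq_zero.1 h2.1, _root_.zero_apply]
    have h4 : M = 0 := Prod.ext h3.1 (Prod.ext h3.2.1 h3.2.2)
    simp [hS, h4] at hM
  obtain ⟨c, hc, hcS⟩ : ∃ c > 0, ∀ M ∈ S, c < Ψ (a, M) := by
    rcases S.eq_empty_or_nonempty with he | hne
    · exact ⟨1, one_pos, by simp [he]⟩
    · obtain ⟨N, hN, hmin⟩ := hSc.exists_isMinOn hne
        (hΨc.comp (Continuous.prodMk_right a)).continuousOn
      refine ⟨Ψ (a, N) / 2, half_pos (hpos N hN), fun M hM => ?_⟩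
      have h1 : Ψ (a, N) ≤ Ψ (a, M) := hmin hM
      have h2 := hpos N hN
      linarith
  refine ⟨c, hc, ?_⟩
  have hnear : ∀ᶠ x in 𝓝 a, ∀ M ∈ S, c < Ψ (x, M) :=
    hSc.eventually_forall_of_forall_eventually fun M hM =>
      (hΨc.tendsto (a, M)).eventually (lt_mem_nhds (hcS M hM))
  have hact : ∀ᶠ x in 𝓝 a, ∀ i, g a i ≠ 0 → g x i ≠ 0 := by
    refine eventually_all.2 fun i => ?_
    by_cases hi : g a i = 0
    · simp [hi]
    · filter_upwards [((hg i).continuous.tendsto a).eventually (isOpen_ne.mem_nhds hi)]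
        with x hx _ using hx
  filter_upwards [hnear, hact] with x hx hxa M hM0 hMg
  rcases eq_or_ne M 0 with rfl | hM
  · simp [multFunctional]
  have hMn : 0 < ‖M‖ := norm_pos_iff.2 hM
  have h1 := hx (‖M‖⁻¹ • M) ⟨by simp [norm_smul, hMn.ne'],
    fun i => mul_nonneg (inv_nonneg.2 hMn.le) (hM0 i), fun i => by
      by_cases hi : g a i = 0
      · simp [hi]
      · have : M.1 i = 0 := by simpa [hxa i hi] using hMg i
        simp [this]⟩
  have h2 : Ψ (x, ‖M‖⁻¹ • M) = ‖M‖⁻¹ * Ψ (x, M) := by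
    simp only [hΨ, multFunctional_smul, norm_smul, mul_add, Finset.mul_sum, Prod.smul_snd,
      Pi.smul_apply, smul_eq_mul, abs_mul, norm_inv, norm_norm, abs_inv, abs_norm]
    congr 1
    exact Finset.sum_congr rfl fun i _ => by ring
  rw [h2, ← div_eq_inv_mul, lt_div_iff₀ hMn] at h1
  exact h1.le

lemma eventually_CCMFCQ (hg : ∀ i, ContDiff ℝ 2 (fun x => g x i))
    (hh : ∀ i, ContDiff ℝ 2 (fun x => h x i)) {a : Fin n → ℝ} (ha : CCMFCQ g h a) :
    ∀ᶠ x in 𝓝 a, CCMFCQ g h x := by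
  obtain ⟨c, hc, hb⟩ := exists_multiplier_bound hg hh ha
  have hsupp : ∀ᶠ x in 𝓝 a, ∀ i, a i ≠ 0 → x i ≠ 0 := by
    refine eventually_all.2 fun i => ?_
    by_cases hi : a i = 0
    · simp [hi]
    · filter_upwards [((continuous_apply i).tendsto a).eventually (isOpen_ne.mem_nhds hi)]
        with x hx _ using hx
  filter_upwards [hb, hsupp] with x hx hxs lam mu gam h1 h2 h3 h4
  have h5 := hx (lam, mu, gam) h1 fun i => by
    by_cases hi : g x i = 0
    · simp [hi]
    · simp [h2 i hi]
  have h6 : multFunctional g h x (lam, mu, gam) = 0 := by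
    ext1 d
    rw [multFunctional_apply]
    exact h4 d
  have h7 : ∑ i, a i ^ 2 * |gam i| = 0 := Finset.sum_eq_zero fun i _ => by
    by_cases hi : a i = 0
    · simp [hi]
    · simp [h3 i (hxs i hi)]
  rw [h6, norm_zero, zero_add, h7] at h5
  have h8 : ((lam, mu, gam) : (Fin m → ℝ) × (Fin p → ℝ) × (Fin n → ℝ)) = 0 := by
    rw [← norm_le_zero_iff]
    nlinarith [norm_nonneg ((lam, mu, gam) : (Fin m → ℝ) × (Fin p → ℝ) × (Fin n → ℝ))]
  simpa using h8

/-- Fritz John multipliers of the regularized program at `z`; `KKTReg` is the case `s = 1`. -/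
def IsFJMultReg (f : (Fin n → ℝ) → ℝ) (g : (Fin n → ℝ) → Fin m → ℝ)
    (h : (Fin n → ℝ) → Fin p → ℝ) (κ : ℕ) (t : ℝ) (z : (Fin n → ℝ) × (Fin n → ℝ)) (s : ℝ)
    (lam : Fin m → ℝ) (mu : Fin p → ℝ) (nu0 nu1 : Fin n → ℝ) (rho : ℝ)
    (dpl dmi : Fin n → ℝ) : Prop :=
  (∀ d : Fin n → ℝ, s * D1 f z.1 d + ∑ i, lam i * D1 (fun x' => g x' i) z.1 d
      + ∑ i, mu i * D1 (fun x' => h x' i) z.1 d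
      + ∑ i, (dpl i - dmi i) * z.2 i * d i = 0) ∧
  (∀ i, -nu0 i + nu1 i - rho + (dpl i - dmi i) * z.1 i = 0) ∧
  (∀ i, 0 ≤ lam i) ∧ (∀ i, 0 ≤ nu0 i) ∧ (∀ i, 0 ≤ nu1 i) ∧ 0 ≤ rho ∧
  (∀ i, 0 ≤ dpl i) ∧ (∀ i, 0 ≤ dmi i) ∧
  (∀ i, lam i * g z.1 i = 0) ∧ (∀ i, nu0 i * z.2 i = 0) ∧ (∀ i, nu1 i * (z.2 i - 1) = 0) ∧
  rho * (∑ i, z.2 i - ((n : ℝ) - (κ : ℝ))) = 0 ∧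
  (∀ i, dpl i * (z.1 i * z.2 i - t) = 0) ∧ (∀ i, dmi i * (z.1 i * z.2 i + t) = 0)

lemma kktReg_iff {κ : ℕ} {t : ℝ} {z : (Fin n → ℝ) × (Fin n → ℝ)} :
    KKTReg f g h κ t z ↔ z ∈ ZReg g h κ t ∧
      ∃ lam mu nu0 nu1 rho dpl dmi, IsFJMultReg f g h κ t z 1 lam mu nu0 nu1 rho dpl dmi := by
  simp [KKTReg, IsFJMultReg]

/-- Multipliers of complementarity constraints outside the support of the reference point
dominate those inside it. -/
lemma exists_sq_mul_abs_le {κ : ℕ} (hκn : κ ≤ n) (a : Fin n → ℝ) :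
    ∃ η > (0 : ℝ), ∀ (t : ℝ) (z : (Fin n → ℝ) × (Fin n → ℝ)) (s : ℝ)
      (lam : Fin m → ℝ) (mu : Fin p → ℝ) (nu0 nu1 : Fin n → ℝ) (rho : ℝ)
      (dpl dmi : Fin n → ℝ), 0 < t → t < η → dist z.1 a < η → z ∈ ZReg g h κ t →
      IsFJMultReg f g h κ t z s lam mu nu0 nu1 rho dpl dmi →
      ∀ i, a i ^ 2 * |(dpl i - dmi i) * z.2 i| ≤
        4 * dist z.1 a ^ 2 * ‖fun i => (dpl i - dmi i) * z.2 i‖ := by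
  obtain ⟨b, hb, hb0⟩ : ∃ b : ℝ, (∀ i, a i ≠ 0 → b ≤ |a i|) ∧ 0 < b := by
    have h1 : ∀ᶠ b in 𝓝[>] (0 : ℝ), ∀ i, a i ≠ 0 → b ≤ |a i| := by
      refine eventually_all.2 fun i => ?_
      by_cases hi : a i = 0
      · simp [hi]
      · filter_upwards [nhdsWithin_le_nhds (eventually_lt_nhds (abs_pos.2 hi))] with b hb _
          using hb.le
    exact (h1.and self_mem_nhdsWithin).exists
  refine ⟨min (b / 2) (b / (2 * (n + 1))), by positivity, ?_⟩
  intro t z s lam mu nu0 nu1 rho dpl dmi ht0 ht hz hZ hM i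
  obtain ⟨-, hy, -, -, -, hrho, -, -, -, hnu0, hnu1, hr, hdpl, hdmi⟩ := hM
  obtain ⟨-, -, hy0, hy1, -, hxy, hyx⟩ := hZ
  by_cases hi : a i = 0
  · have : (0 : ℝ) ^ 2 = 0 := by norm_num
    rw [hi, this, zero_mul]
    positivity
  by_cases hgi : (dpl i - dmi i) * z.2 i = 0
  · rw [hgi, abs_zero, mul_zero]
    positivity
  have hdist : ∀ j, |z.1 j - a j| ≤ dist z.1 a := fun j => by
    rw [← Real.dist_eq]; exact dist_le_pi_dist _ _ j
  have hdb : dist z.1 a < b / 2 := hz.trans_le (min_le_left _ _)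
  have htb : t < b / (2 * (n + 1)) := ht.trans_le (min_le_right _ _)
  have hxa : ∀ j, a j ≠ 0 → |a j| ≤ 2 * |z.1 j| ∧ b ≤ 2 * |z.1 j| := fun j hj => by
    have h1 := hdist j
    have h2 := hb j hj
    have h3 := abs_sub_abs_le_abs_sub (a j) (z.1 j)
    rw [abs_sub_comm] at h3
    constructor <;> linarith
  have habs : ∀ j, |z.1 j| * z.2 j ≤ t := fun j => by
    rw [← abs_of_nonneg (hy0 j), ← abs_mul]
    exact abs_le.2 ⟨hyx j, hxy j⟩
  have hysmall : ∀ j, a j ≠ 0 → z.2 j * (n + 1) < 1 := fun j hj => by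
    rw [lt_div_iff₀ (by positivity)] at htb
    have h1 := habs j
    have h2 := (hxa j hj).2
    have h3 : b * z.2 j ≤ 2 * t := by nlinarith [hy0 j]
    have h4 : b * (z.2 j * (n + 1)) < b * 1 := by nlinarith [(by positivity : (0:ℝ) ≤ n + 1)]
    exact lt_of_mul_lt_mul_left h4 hb0.le
  have hactive : ∀ j, dpl j - dmi j ≠ 0 → |z.1 j| * z.2 j = t := fun j hj => by
    rw [← abs_of_nonneg (hy0 j), ← abs_mul]
    by_cases hd : dpl j = 0
    · have hm : dmi j ≠ 0 := fun h0 => hj (by rw [hd, h0, sub_zero])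
      have : z.1 j * z.2 j = -t := by
        have := (mul_eq_zero.1 (hdmi j)).resolve_left hm
        linarith
      rw [this, abs_neg, abs_of_pos ht0]
    · have : z.1 j * z.2 j = t := by
        have := (mul_eq_zero.1 (hdpl j)).resolve_left hd
        linarith
      rw [this, abs_of_pos ht0]
  have hmid : ∀ j, 0 < z.2 j → z.2 j < 1 → (dpl j - dmi j) * z.1 j = rho := fun j h1 h2 => by
    have h3 := (mul_eq_zero.1 (hnu0 j)).resolve_right h1.ne'
    have h4 := (mul_eq_zero.1 (hnu1 j)).resolve_right (by linarith)
    have := hy j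
    rw [h3, h4] at this
    linarith
  have hδi : dpl i - dmi i ≠ 0 := left_ne_zero_of_mul hgi
  have hyi : 0 < z.2 i := lt_of_le_of_ne (hy0 i) (right_ne_zero_of_mul hgi).symm
  have hn0 : (0 : ℝ) ≤ n := Nat.cast_nonneg n
  have hyi1 : z.2 i < 1 := by nlinarith [hysmall i hi]
  have hri := hmid i hyi hyi1
  have hxi : z.1 i ≠ 0 := fun h0 => by
    have := (hxa i hi).2
    rw [h0, abs_zero] at this
    linarith
  have hrho0 : rho ≠ 0 := hri ▸ mul_ne_zero hδi hxi
  have hsum : ∑ j, z.2 j = (n : ℝ) - κ := by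
    have := (mul_eq_zero.1 hr).resolve_left hrho0
    linarith
  obtain ⟨l, hl, hl0, hl1⟩ : ∃ l, a l = 0 ∧ 0 < z.2 l ∧ z.2 l < 1 := by
    by_contra! hcon
    have h01 : ∀ l, a l = 0 → z.2 l = if z.2 l = 0 then 0 else 1 := fun l hl => by
      split_ifs with h0
      · exact h0
      · exact le_antisymm (hy1 l) (hcon l hl (lt_of_le_of_ne (hy0 l) (Ne.symm h0)))
    classical
    have hsplit := Finset.sum_filter_add_sum_filter_not Finset.univ (fun l => a l = 0) z.2
    have hA : ∑ l with a l = 0, z.2 l =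
        (({l : Fin n | a l = 0} : Finset (Fin n)).filter fun l => z.2 l ≠ 0).card := by
      rw [Finset.card_filter, Nat.cast_sum]
      refine Finset.sum_congr rfl fun l hl => ?_
      rw [h01 l (Finset.mem_filter.1 hl).2]
      by_cases h0 : z.2 l = 0 <;> simp [h0]
    have hBpos : 0 < ∑ l with ¬ a l = 0, z.2 l :=
      Finset.sum_pos' (fun l _ => hy0 l) ⟨i, by simp [hi], hyi⟩
    have hB1 : ∑ l with ¬ a l = 0, z.2 l < 1 := by
      have h1 : ∑ l with ¬ a l = 0, z.2 l * (n + 1) ≤ n := by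
        calc _ ≤ ∑ l : Fin n with ¬ a l = 0, (1 : ℝ) :=
              Finset.sum_le_sum fun l hl => (hysmall l (Finset.mem_filter.1 hl).2).le
          _ ≤ ∑ l : Fin n, (1 : ℝ) :=
              Finset.sum_le_sum_of_subset_of_nonneg (Finset.filter_subset _ _) (by simp)
          _ = n := by simp
      rw [← Finset.sum_mul] at h1
      by_contra! h2
      nlinarith
    rw [hsum, hA] at hsplit
    generalize (({l : Fin n | a l = 0} : Finset (Fin n)).filter fun l => z.2 l ≠ 0).card = N
      at hsplit
    rw [← Nat.cast_sub hκn] at hsplit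
    have h1 : N < n - κ := by
      have : (N : ℝ) < (n - κ : ℕ) := by linarith
      exact_mod_cast this
    have h2 : n - κ < N + 1 := by
      have : ((n - κ : ℕ) : ℝ) < (N + 1 : ℕ) := by push_cast; linarith
      exact_mod_cast this
    omega
  have hrl := hmid l hl0 hl1
  have hδl : dpl l - dmi l ≠ 0 := fun h0 => hrho0 (by rw [← hrl, h0, zero_mul])
  have key : ∀ j, dpl j - dmi j ≠ 0 → (dpl j - dmi j) * z.1 j = rho →
      |(dpl j - dmi j) * z.2 j| * |z.1 j| ^ 2 = rho * t := fun j h1 h2 => by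
    rw [← hactive j h1, ← abs_of_nonneg hrho, ← h2, abs_mul, abs_mul, abs_of_nonneg (hy0 j)]
    ring
  have hki := key i hδi hri
  have hkl := key l hδl hrl
  have hxl : |z.1 l| ≤ dist z.1 a := by simpa [hl] using hdist l
  have hnorm : |(dpl l - dmi l) * z.2 l| ≤ ‖fun i => (dpl i - dmi i) * z.2 i‖ := by
    have := norm_le_pi_norm (fun i => (dpl i - dmi i) * z.2 i) l
    simpa only [Real.norm_eq_abs] using this
  calc a i ^ 2 * |(dpl i - dmi i) * z.2 i|
      = |a i| ^ 2 * |(dpl i - dmi i) * z.2 i| := by rw [sq_abs]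
    _ ≤ (2 * |z.1 i|) ^ 2 * |(dpl i - dmi i) * z.2 i| := by
        gcongr
        exact (hxa i hi).1
    _ = 4 * (|(dpl i - dmi i) * z.2 i| * |z.1 i| ^ 2) := by ring
    _ = 4 * |z.1 l| ^ 2 * |(dpl l - dmi l) * z.2 l| := by rw [hki, ← hkl]; ring
    _ ≤ 4 * dist z.1 a ^ 2 * ‖fun i => (dpl i - dmi i) * z.2 i‖ := by gcongr

lemma multFunctional_eq_neg_smul {x : Fin n → ℝ} {s : ℝ} {lam : Fin m → ℝ} {mu : Fin p → ℝ}
    {gam : Fin n → ℝ}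
    (hM : ∀ d, s * D1 f x d + ∑ i, lam i * D1 (fun x' => g x' i) x d
      + ∑ i, mu i * D1 (fun x' => h x' i) x d + ∑ i, gam i * d i = 0) :
    multFunctional g h x (lam, mu, gam) = -(s • fderiv ℝ f x) := by
  ext1 d
  rw [multFunctional_apply, _root_.neg_apply, _root_.smul_apply, smul_eq_mul,
    ← D1_eq_fderiv]
  linarith [hM d]

lemma eventually_norm_fderiv_le (hf : ContDiff ℝ 2 f) (a : Fin n → ℝ) :
    ∃ B ≥ (0 : ℝ), ∀ᶠ x in 𝓝 a, ‖fderiv ℝ f x‖ ≤ B :=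
  ⟨‖fderiv ℝ f a‖ + 1, by positivity,
    (((hf.continuous_fderiv two_ne_zero).norm.tendsto a).eventually
      (gt_mem_nhds (lt_add_one _))).mono fun _ => le_of_lt⟩

/-- Fritz John multipliers of NLP(t) are bounded by the multiplier of the objective. -/
lemma exists_fjMult_bound (hf : ContDiff ℝ 2 f) (hg : ∀ i, ContDiff ℝ 2 (fun x => g x i))
    (hh : ∀ i, ContDiff ℝ 2 (fun x => h x i)) {κ : ℕ} (hκn : κ ≤ n) {a : Fin n → ℝ}
    (ha : CCMFCQ g h a) :
    ∃ C : ℝ, ∃ η > (0 : ℝ), ∀ (t : ℝ) (z : (Fin n → ℝ) × (Fin n → ℝ)) (s : ℝ)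
      (lam : Fin m → ℝ) (mu : Fin p → ℝ) (nu0 nu1 : Fin n → ℝ) (rho : ℝ)
      (dpl dmi : Fin n → ℝ), 0 < t → t < η → dist z.1 a < η → z ∈ ZReg g h κ t → 0 ≤ s →
      IsFJMultReg f g h κ t z s lam mu nu0 nu1 rho dpl dmi →
      ‖(lam, mu, fun i => (dpl i - dmi i) * z.2 i)‖ ≤ C * s := by
  obtain ⟨c, hc, hcb⟩ := exists_multiplier_bound hg hh ha
  obtain ⟨B, hB0, hB⟩ := eventually_norm_fderiv_le hf a
  obtain ⟨η₁, hη₁, hG⟩ := exists_sq_mul_abs_le (f := f) (g := g) (h := h) hκn a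
  obtain ⟨η₂, hη₂, hnear⟩ := Metric.eventually_nhds_iff.1 (hcb.and hB)
  have hlim : ∀ᶠ η in 𝓝[>] (0 : ℝ), (n : ℝ) * (4 * η ^ 2) < c / 2 := by
    refine nhdsWithin_le_nhds (Tendsto.eventually_lt_const (v := 0) (half_pos hc) ?_)
    have : Continuous fun η : ℝ => (n : ℝ) * (4 * η ^ 2) := by fun_prop
    simpa using this.tendsto 0
  obtain ⟨η₃, hη₃, hη₃0⟩ := (hlim.and self_mem_nhdsWithin).exists
  have hη₃0 : 0 < η₃ := hη₃0
  refine ⟨2 * B / c, min η₁ (min η₂ η₃), by positivity, ?_⟩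
  intro t z s lam mu nu0 nu1 rho dpl dmi ht0 ht hz hZ hs hM
  obtain ⟨hz1, hz2, hz3⟩ : dist z.1 a < η₁ ∧ dist z.1 a < η₂ ∧ dist z.1 a < η₃ := by
    simpa using hz
  have h1 := hG t z s lam mu nu0 nu1 rho dpl dmi ht0 (ht.trans_le (min_le_left _ _)) hz1 hZ hM
  obtain ⟨h2, h3⟩ := hnear hz2
  obtain ⟨hx, -, hl0, -, -, -, -, -, hlg, -⟩ := hM
  set gam : Fin n → ℝ := fun i => (dpl i - dmi i) * z.2 i with hgam
  have h4 := h2 (lam, mu, gam) hl0 hlg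
  rw [multFunctional_eq_neg_smul hx, norm_neg, norm_smul, Real.norm_of_nonneg hs] at h4
  set N := ‖(lam, mu, gam)‖ with hN
  have hgN : ‖gam‖ ≤ N := by simp [hN]
  have h5 : ∑ i, a i ^ 2 * |gam i| ≤ c / 2 * N := by
    calc ∑ i, a i ^ 2 * |gam i| ≤ ∑ _i : Fin n, 4 * η₃ ^ 2 * N := by
          refine Finset.sum_le_sum fun i _ => (h1 i).trans ?_
          gcongr
      _ = n * (4 * η₃ ^ 2) * N := by simp; ring
      _ ≤ c / 2 * N := by gcongr
  have h6 : s * ‖fderiv ℝ f z.1‖ ≤ s * B := by gcongr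
  rw [div_mul_eq_mul_div, le_div_iff₀ hc]
  linarith

/-- A local minimizer of NLP(t) admits nontrivial Fritz John multipliers. -/
lemma exists_fjMultReg (hf : ContDiff ℝ 2 f) (hg : ∀ i, ContDiff ℝ 2 (fun x => g x i))
    (hh : ∀ i, ContDiff ℝ 2 (fun x => h x i)) {κ : ℕ} {t : ℝ}
    {z : (Fin n → ℝ) × (Fin n → ℝ)} (hz : z ∈ ZReg g h κ t)
    (hmin : IsLocalMinOn (fun w : (Fin n → ℝ) × (Fin n → ℝ) => f w.1) (ZReg g h κ t) z) :
    ∃ s lam mu nu0 nu1 rho dpl dmi, 0 ≤ s ∧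
      IsFJMultReg f g h κ t z s lam mu nu0 nu1 rho dpl dmi ∧
      ¬(s = 0 ∧ lam = 0 ∧ mu = 0 ∧ nu0 = 0 ∧ nu1 = 0 ∧ rho = 0 ∧ dpl = 0 ∧ dmi = 0) := by
  let G : Fin m ⊕ Fin n ⊕ Fin n ⊕ Unit ⊕ Fin n ⊕ Fin n → (Fin n → ℝ) × (Fin n → ℝ) → ℝ :=
    Sum.elim (fun i w => g w.1 i) <| Sum.elim (fun i w => -w.2 i) <|
    Sum.elim (fun i w => w.2 i - 1) <| Sum.elim (fun _ w => (n : ℝ) - κ - ∑ i, w.2 i) <|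
    Sum.elim (fun i w => w.1 i * w.2 i - t) fun i w => -t - w.1 i * w.2 i
  have hGc : ∀ i, ContDiff ℝ 1 (G i) := by
    have hg1 := fun i => (hg i).of_le one_le_two
    rintro (i | i | i | i | i | i) <;> simp only [G, Sum.elim_inl, Sum.elim_inr]
    · exact (hg1 i).comp contDiff_fst
    all_goals fun_prop
  have hset : {w | (∀ i, G i w ≤ 0) ∧ ∀ j, h w.1 j = 0} = ZReg g h κ t := by
    ext w
    simp only [G, ZReg, Set.mem_ofPred_eq, Sum.forall, Sum.elim_inl, Sum.elim_inr]
    constructor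
    · rintro ⟨⟨h1, h2, h3, h4, h5, h6⟩, h7⟩
      exact ⟨h1, h7, fun i => by linarith [h2 i], fun i => by linarith [h3 i],
        by linarith [h4 ()], fun i => by linarith [h5 i], fun i => by linarith [h6 i]⟩
    · rintro ⟨h1, h7, h2, h3, h4, h5, h6⟩
      exact ⟨⟨h1, fun i => by linarith [h2 i], fun i => by linarith [h3 i],
        fun _ => by linarith, fun i => by linarith [h5 i], fun i => by linarith [h6 i]⟩, h7⟩
  have hz' : z ∈ {w | (∀ i, G i w ≤ 0) ∧ ∀ j, h w.1 j = 0} := hset ▸ hz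
  obtain ⟨s, L, mu, hs, hL, hne, hLG, hst⟩ := fritz_john
    (fun w : (Fin n → ℝ) × (Fin n → ℝ) => f w.1) G (fun j w => h w.1 j)
    ((hf.of_le one_le_two).comp contDiff_fst) hGc
    (fun j => ((hh j).of_le one_le_two).comp contDiff_fst) z hz'.1 hz'.2 (by rw [hset]; exact hmin)
  have hcomp : ∀ {φ : (Fin n → ℝ) → ℝ}, ContDiff ℝ 2 φ → ∀ d : (Fin n → ℝ) × (Fin n → ℝ),
      fderiv ℝ (fun w : (Fin n → ℝ) × (Fin n → ℝ) => φ w.1) z d = D1 φ z.1 d.1 := by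
    intro φ hφ d
    have := ((hφ.differentiable two_ne_zero z.1).hasFDerivAt).comp z hasFDerivAt_fst
    exact congrArg (fun L => L d) this.fderiv
  have h1 : ∀ i, HasFDerivAt (fun w : (Fin n → ℝ) × (Fin n → ℝ) => w.1 i)
      ((ContinuousLinearMap.proj i).comp (ContinuousLinearMap.fst ℝ (Fin n → ℝ) (Fin n → ℝ))) z :=
    fun i => ((ContinuousLinearMap.proj (R := ℝ) (φ := fun _ : Fin n => ℝ) i).comp
      (ContinuousLinearMap.fst ℝ (Fin n → ℝ) (Fin n → ℝ))).hasFDerivAt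
  have h2 : ∀ i, HasFDerivAt (fun w : (Fin n → ℝ) × (Fin n → ℝ) => w.2 i)
      ((ContinuousLinearMap.proj i).comp (ContinuousLinearMap.snd ℝ (Fin n → ℝ) (Fin n → ℝ))) z :=
    fun i => ((ContinuousLinearMap.proj (R := ℝ) (φ := fun _ : Fin n => ℝ) i).comp
      (ContinuousLinearMap.snd ℝ (Fin n → ℝ) (Fin n → ℝ))).hasFDerivAt
  have e1 : ∀ i d, fderiv ℝ (fun w : (Fin n → ℝ) × (Fin n → ℝ) => -w.2 i) z d = -d.2 i :=
    fun i d => by rw [(h2 i).fun_neg.fderiv]; simp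
  have e2 : ∀ i d, fderiv ℝ (fun w : (Fin n → ℝ) × (Fin n → ℝ) => w.2 i - 1) z d = d.2 i :=
    fun i d => by rw [((h2 i).sub_const 1).fderiv]; simp
  have e3 : ∀ d, fderiv ℝ (fun w : (Fin n → ℝ) × (Fin n → ℝ) => (n : ℝ) - κ - ∑ i, w.2 i) z d
      = -∑ i, d.2 i :=
    fun d => by
      rw [((HasFDerivAt.fun_sum fun i (_ : i ∈ Finset.univ) => h2 i).const_sub _).fderiv]
      simp
  have e4 : ∀ i d, fderiv ℝ (fun w : (Fin n → ℝ) × (Fin n → ℝ) => w.1 i * w.2 i - t) z d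
      = z.1 i * d.2 i + z.2 i * d.1 i :=
    fun i d => by rw [(((h1 i).fun_mul (h2 i)).sub_const t).fderiv]; simp
  have e5 : ∀ i d, fderiv ℝ (fun w : (Fin n → ℝ) × (Fin n → ℝ) => -t - w.1 i * w.2 i) z d
      = -(z.1 i * d.2 i + z.2 i * d.1 i) :=
    fun i d => by rw [(((h1 i).fun_mul (h2 i)).const_sub (-t)).fderiv]; simp
  simp only [G, Fintype.sum_sum_type, Sum.elim_inl, Sum.elim_inr, hcomp hf, hcomp (hg _),
    hcomp (hh _), e1, e2, e3, e4, e5, Finset.univ_unique, Finset.sum_singleton] at hst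
  simp only [G, Sum.forall, Sum.elim_inl, Sum.elim_inr] at hLG hL
  obtain ⟨g1, g2, g3, g4, g5, g6⟩ := hLG
  obtain ⟨l1, l2, l3, l4, l5, l6⟩ := hL
  refine ⟨s, fun i => L (.inl i), mu, fun i => L (.inr (.inl i)), fun i => L (.inr (.inr (.inl i))),
    L (.inr (.inr (.inr (.inl ())))), fun i => L (.inr (.inr (.inr (.inr (.inl i))))),
    fun i => L (.inr (.inr (.inr (.inr (.inr i))))), hs,
    ⟨fun d => ?_, fun i => ?_, l1, l2, l3, l4 (), l5, l6, g1, fun i => ?_, g3, ?_, g5,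
      fun i => ?_⟩, ?_⟩
  · have := hst (d, 0)
    simp only [Pi.zero_apply, neg_zero, mul_zero, Finset.sum_const_zero, zero_add] at this
    rw [← this]
    simp only [sub_mul, Finset.sum_sub_distrib, mul_neg, Finset.sum_neg_distrib, mul_assoc]
    ring
  · have hz0 : ∀ φ : (Fin n → ℝ) → ℝ, D1 φ z.1 0 = 0 := fun φ => map_zero _
    have := hst (0, Pi.single i 1)
    simp only [Pi.zero_apply, mul_zero, add_zero, hz0, Finset.sum_const_zero, zero_add,
      Finset.mem_univ, if_true, mul_neg, Finset.sum_neg_distrib,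
      Pi.single_apply, mul_ite, mul_one, Finset.sum_ite_eq', default] at this
    rw [← this]
    ring
  · linarith [g2 i]
  · linarith [g4 ()]
  · linarith [g6 i]
  · rintro ⟨r1, r2, r3, r4, r5, r6, r7, r8⟩
    refine hne ⟨r1, funext ?_, r3⟩
    rintro (i | i | i | i | i | i)
    exacts [congrFun r2 i, congrFun r4 i, congrFun r5 i, r6, congrFun r7 i, congrFun r8 i]

/-- Near a point satisfying CC-MFCQ, local minimizers of NLP(t) are KKT points for small `t`. -/
lemma exists_kktReg_of_isLocalMinOn (hf : ContDiff ℝ 2 f)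
    (hg : ∀ i, ContDiff ℝ 2 (fun x => g x i)) (hh : ∀ i, ContDiff ℝ 2 (fun x => h x i)) {κ : ℕ}
    (hκ0 : 0 < κ) (hκn : κ < n) {a : Fin n → ℝ} (ha : CCMFCQ g h a) :
    ∃ η > (0 : ℝ), ∀ (t : ℝ) (z : (Fin n → ℝ) × (Fin n → ℝ)), 0 < t → t < η → dist z.1 a < η →
      z ∈ ZReg g h κ t →
      IsLocalMinOn (fun w : (Fin n → ℝ) × (Fin n → ℝ) => f w.1) (ZReg g h κ t) z →
      KKTReg f g h κ t z := by
  obtain ⟨C, η, hη, hb⟩ := exists_fjMult_bound hf hg hh hκn.le ha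
  refine ⟨η, hη, fun t z ht0 ht hz hZ hmin => ?_⟩
  obtain ⟨s, lam, mu, nu0, nu1, rho, dpl, dmi, hs, hM, hne⟩ := exists_fjMultReg hf hg hh hZ hmin
  have hbd := hb t z s lam mu nu0 nu1 rho dpl dmi ht0 ht hz hZ hs hM
  obtain ⟨c1, c2, c3, c4, c5, c6, c7, c8, c9, c10, c11, c12, c13, c14⟩ := hM
  have hs0 : s ≠ 0 := by
    rintro rfl
    have hzero : (lam, mu, fun i => (dpl i - dmi i) * z.2 i) = 0 := by
      rw [← norm_le_zero_iff]
      simpa using hbd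
    simp only [Prod.mk_eq_zero] at hzero
    obtain ⟨hlam, hmu, hgam⟩ := hzero
    have hcase : ∀ i, dpl i = 0 ∧ dmi i = 0 := fun i => by
      have h0 : (dpl i - dmi i) * z.2 i = 0 := congrFun hgam i
      have hp := c13 i
      have hm := c14 i
      by_cases hy : z.2 i = 0
      · rw [hy] at hp hm
        constructor
        · nlinarith
        · nlinarith
      · have h1 : dpl i = dmi i := by
          have := (mul_eq_zero.1 h0).resolve_right hy
          linarith
        rw [h1] at hp
        have h2 : dmi i * t = 0 := by linarith
        have h3 := (mul_eq_zero.1 h2).resolve_right ht0.ne'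
        exact ⟨h1.trans h3, h3⟩
    have hnu : ∀ i, nu1 i = rho + nu0 i := fun i => by
      have := c2 i
      rw [(hcase i).1, (hcase i).2] at this
      linarith
    have hrho : rho = 0 := by
      by_contra hr
      have hr0 : 0 < rho := lt_of_le_of_ne c6 (Ne.symm hr)
      have hy : ∀ i, z.2 i = 1 := fun i => by
        have h1 : nu1 i ≠ 0 := by
          rw [hnu i]
          exact (add_pos_of_pos_of_nonneg hr0 (c4 i)).ne'
        linarith [(mul_eq_zero.1 (c11 i)).resolve_left h1]
      have h2 := (mul_eq_zero.1 c12).resolve_left hr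
      simp [hy] at h2
      omega
    have hnu0 : ∀ i, nu0 i = 0 := fun i => by
      have h1 := c11 i
      rw [hnu i, hrho, zero_add, mul_sub, c10 i] at h1
      linarith
    refine hne ⟨rfl, hlam, hmu, funext hnu0, funext fun i => ?_, hrho,
      funext fun i => (hcase i).1, funext fun i => (hcase i).2⟩
    rw [hnu i, hrho, hnu0 i]
    simp
  have hs1 : 0 < s := lt_of_le_of_ne hs hs0.symm
  have hsi : 0 ≤ s⁻¹ := (inv_pos.2 hs1).le
  refine kktReg_iff.2 ⟨hZ, fun i => s⁻¹ * lam i, fun i => s⁻¹ * mu i, fun i => s⁻¹ * nu0 i,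
    fun i => s⁻¹ * nu1 i, s⁻¹ * rho, fun i => s⁻¹ * dpl i, fun i => s⁻¹ * dmi i,
    fun d => ?_, fun i => ?_, fun i => mul_nonneg hsi (c3 i), fun i => mul_nonneg hsi (c4 i),
    fun i => mul_nonneg hsi (c5 i), mul_nonneg hsi c6, fun i => mul_nonneg hsi (c7 i),
    fun i => mul_nonneg hsi (c8 i), fun i => ?_, fun i => ?_, fun i => ?_, ?_, fun i => ?_,
    fun i => ?_⟩
  · have h1 := congrArg (fun v => s⁻¹ * v) (c1 d)
    simp only [mul_add, Finset.mul_sum, mul_zero, ← mul_assoc, inv_mul_cancel₀ hs0, mul_sub] at h1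
    simp only [mul_assoc] at h1 ⊢
    exact h1
  · linear_combination s⁻¹ * c2 i
  · rw [mul_assoc, c9 i, mul_zero]
  · rw [mul_assoc, c10 i, mul_zero]
  · rw [mul_assoc, c11 i, mul_zero]
  · rw [mul_assoc, c12, mul_zero]
  · rw [mul_assoc, c13 i, mul_zero]
  · rw [mul_assoc, c14 i, mul_zero]

/-! ### Limits of feasible points and stationary points -/

lemma mem_ZSet_of_tendsto (hg : ∀ i, Continuous fun x => g x i)
    (hh : ∀ i, Continuous fun x => h x i) {κ : ℕ} {α : Type*} {l : Filter α} [l.NeBot]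
    {t : α → ℝ} {z : α → (Fin n → ℝ) × (Fin n → ℝ)} {z₀ : (Fin n → ℝ) × (Fin n → ℝ)}
    (ht : Tendsto t l (𝓝 0)) (hz : ∀ᶠ k in l, z k ∈ ZReg g h κ (t k))
    (hz₀ : Tendsto z l (𝓝 z₀)) : z₀ ∈ ZSet g h κ := by
  have hx : Tendsto (fun k => (z k).1) l (𝓝 z₀.1) := (continuous_fst.tendsto z₀).comp hz₀
  have hy : Tendsto (fun k => (z k).2) l (𝓝 z₀.2) := (continuous_snd.tendsto z₀).comp hz₀
  have hxi := fun i => ((continuous_apply i).tendsto z₀.1).comp hx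
  have hyi := fun i => ((continuous_apply i).tendsto z₀.2).comp hy
  refine ⟨fun i => ?_, fun i => ?_, fun i => ?_, fun i => ?_, ?_, fun i => le_antisymm ?_ ?_⟩
  · exact le_of_tendsto (((hg i).tendsto z₀.1).comp hx) (hz.mono fun k hk => hk.1 i)
  · exact tendsto_nhds_unique (((hh i).tendsto z₀.1).comp hx)
      (tendsto_const_nhds.congr' (hz.mono fun k hk => (hk.2.1 i).symm))
  · exact ge_of_tendsto (hyi i) (hz.mono fun k hk => hk.2.2.1 i)
  · exact le_of_tendsto (hyi i) (hz.mono fun k hk => hk.2.2.2.1 i)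
  · exact ge_of_tendsto (tendsto_finsetSum Finset.univ fun i _ => hyi i)
      (hz.mono fun k hk => hk.2.2.2.2.1)
  · exact le_of_tendsto_of_tendsto ((hxi i).mul (hyi i)) ht
      (hz.mono fun k hk => hk.2.2.2.2.2.1 i)
  · have := ht.neg
    rw [neg_zero] at this
    exact le_of_tendsto_of_tendsto this ((hxi i).mul (hyi i))
      (hz.mono fun k hk => hk.2.2.2.2.2.2 i)

lemma ncard_eq_zero_add_card0 (x : Fin n → ℝ) : {i | x i = 0}.ncard + card0 x = n := by
  have h1 := Set.ncard_add_ncard_compl {i | x i = 0}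
  rw [Nat.card_eq_fintype_card, Fintype.card_fin] at h1
  exact h1

lemma ccpFeasible_of_mem_ZSet {κ : ℕ} {z : (Fin n → ℝ) × (Fin n → ℝ)} (hz : z ∈ ZSet g h κ) :
    CCPFeasible g h κ z.1 := by
  obtain ⟨h1, h2, h3, h4, h5, h6⟩ := hz
  refine ⟨h1, h2, ?_⟩
  have h7 : ∑ i, z.2 i ≤ ({i | z.1 i = 0}.ncard : ℝ) := by
    classical
    calc ∑ i, z.2 i ≤ ∑ i, if z.1 i = 0 then (1 : ℝ) else 0 := by
          refine Finset.sum_le_sum fun i _ => ?_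
          split_ifs with hi
          · exact h4 i
          · exact ((mul_eq_zero.1 (h6 i)).resolve_left hi).le
      _ = ({i | z.1 i = 0}.ncard : ℝ) := by
          rw [Finset.sum_boole, Set.ncard_eq_toFinset_card']
          simp
  have h8 := ncard_eq_zero_add_card0 z.1
  have h9 : n ≤ {i | z.1 i = 0}.ncard + κ := by
    have : (n : ℝ) ≤ ({i | z.1 i = 0}.ncard + κ : ℕ) := by
      push_cast
      linarith
    exact_mod_cast this
  omega

/-- The pair `(x, 1 - sign |x|)` is feasible for NLP(t) when `x` is feasible for CCP. -/
lemma exists_mem_ZReg {κ : ℕ} {x : Fin n → ℝ} (hx : CCPFeasible g h κ x) {t : ℝ} (ht : 0 ≤ t) :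
    ∃ y, (x, y) ∈ ZReg g h κ t := by
  classical
  refine ⟨fun i => if x i = 0 then 1 else 0, hx.1, hx.2.1, fun i => ?_, fun i => ?_, ?_,
    fun i => ?_, fun i => ?_⟩
  · dsimp only
    split_ifs <;> norm_num
  · dsimp only
    split_ifs <;> norm_num
  · have h1 := ncard_eq_zero_add_card0 x
    have h2 := hx.2.2
    have h3 : ∑ i, (if x i = 0 then (1 : ℝ) else 0) = ({i | x i = 0}.ncard : ℝ) := by
      rw [Finset.sum_boole, Set.ncard_eq_toFinset_card']
      simp
    rw [h3]
    have h4 : (n : ℝ) ≤ ({i | x i = 0}.ncard + κ : ℕ) := by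
      exact_mod_cast (by omega : n ≤ {i | x i = 0}.ncard + κ)
    push_cast at h4
    linarith
  · dsimp only
    split_ifs with hi <;> simp [hi, ht]
  · dsimp only
    split_ifs with hi <;> simp [hi, ht]

lemma tendsto_D1 {φ : (Fin n → ℝ) → ℝ} (hφ : ContDiff ℝ 2 φ) {α : Type*} {l : Filter α}
    {x : α → Fin n → ℝ} {a : Fin n → ℝ} (hx : Tendsto x l (𝓝 a)) (d : Fin n → ℝ) :
    Tendsto (fun k => D1 φ (x k) d) l (𝓝 (D1 φ a d)) :=
  (((hφ.continuous_fderiv two_ne_zero).clm_apply continuous_const).tendsto a).comp hx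

/-- Limits of (possibly only approximately complementary) M-stationary multipliers. -/
lemma isMMult_of_tendsto (hf : ContDiff ℝ 2 f) (hg : ∀ i, ContDiff ℝ 2 (fun x => g x i))
    (hh : ∀ i, ContDiff ℝ 2 (fun x => h x i)) {α : Type*} {l : Filter α} [l.NeBot]
    {x : α → Fin n → ℝ} {a : Fin n → ℝ} (hx : Tendsto x l (𝓝 a))
    {M : α → (Fin m → ℝ) × (Fin p → ℝ) × (Fin n → ℝ)}
    {N : (Fin m → ℝ) × (Fin p → ℝ) × (Fin n → ℝ)} (hM : Tendsto M l (𝓝 N))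
    (hst : ∀ᶠ k in l, (∀ d, D1 f (x k) d + ∑ i, (M k).1 i * D1 (fun x' => g x' i) (x k) d
      + ∑ i, (M k).2.1 i * D1 (fun x' => h x' i) (x k) d + ∑ i, (M k).2.2 i * d i = 0) ∧
      (∀ i, 0 ≤ (M k).1 i) ∧ ∀ i, (M k).1 i * g (x k) i = 0)
    (hN : ∀ i, a i ≠ 0 → N.2.2 i = 0) : IsMMult f g h a N.1 N.2.1 N.2.2 := by
  have h1 : ∀ i, Tendsto (fun k => (M k).1 i) l (𝓝 (N.1 i)) := fun i =>
    (((continuous_apply i).comp continuous_fst).tendsto N).comp hM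
  have h2 : ∀ i, Tendsto (fun k => (M k).2.1 i) l (𝓝 (N.2.1 i)) := fun i =>
    (((continuous_apply i).comp (continuous_fst.comp continuous_snd)).tendsto N).comp hM
  have h3 : ∀ i, Tendsto (fun k => (M k).2.2 i) l (𝓝 (N.2.2 i)) := fun i =>
    (((continuous_apply i).comp (continuous_snd.comp continuous_snd)).tendsto N).comp hM
  refine ⟨fun d => ?_, fun i => ?_, fun i => ?_, hN⟩
  · refine tendsto_nhds_unique ((((tendsto_D1 hf hx d).add
      (tendsto_finsetSum Finset.univ fun i _ => (h1 i).mul (tendsto_D1 (hg i) hx d))).add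
      (tendsto_finsetSum Finset.univ fun i _ => (h2 i).mul (tendsto_D1 (hh i) hx d))).add
      (tendsto_finsetSum Finset.univ fun i _ => (h3 i).mul_const (d i)))
      (tendsto_const_nhds.congr' (hst.mono fun k hk => (hk.1 d).symm))
  · exact ge_of_tendsto (h1 i) (hst.mono fun k hk => hk.2.1 i)
  · exact tendsto_nhds_unique ((h1 i).mul (((hg i).continuous.tendsto a).comp hx))
      (tendsto_const_nhds.congr' (hst.mono fun k hk => (hk.2.2 i).symm))

/-- Limits of KKT points of NLP(t) are M-stationary under CC-MFCQ. -/
lemma exists_isMMult_of_tendsto_kktReg (hf : ContDiff ℝ 2 f)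
    (hg : ∀ i, ContDiff ℝ 2 (fun x => g x i)) (hh : ∀ i, ContDiff ℝ 2 (fun x => h x i)) {κ : ℕ}
    (hκn : κ ≤ n) {α : Type*} (U : Ultrafilter α) {t : α → ℝ} (ht0 : ∀ k, 0 < t k)
    (ht : Tendsto t U (𝓝 0)) {z : α → (Fin n → ℝ) × (Fin n → ℝ)} {a : Fin n → ℝ}
    (hz : ∀ᶠ k in U, KKTReg f g h κ (t k) (z k)) (hx : Tendsto (fun k => (z k).1) U (𝓝 a))
    (ha : CCMFCQ g h a) :
    ∃ lam mu gam, IsMMult f g h a lam mu gam := by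
  obtain ⟨C, η₁, hη₁, hC⟩ := exists_fjMult_bound hf hg hh hκn ha
  obtain ⟨η₂, hη₂, hG⟩ := exists_sq_mul_abs_le (f := f) (g := g) (h := h) hκn a
  have hmult : ∀ k, ∃ M : (Fin m → ℝ) × (Fin p → ℝ) × (Fin n → ℝ), KKTReg f g h κ (t k) (z k) →
      dist (z k).1 a < min η₁ η₂ → t k < min η₁ η₂ →
      ((∀ d, D1 f (z k).1 d + ∑ i, M.1 i * D1 (fun x' => g x' i) (z k).1 d
      + ∑ i, M.2.1 i * D1 (fun x' => h x' i) (z k).1 d + ∑ i, M.2.2 i * d i = 0) ∧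
      (∀ i, 0 ≤ M.1 i) ∧ ∀ i, M.1 i * g (z k).1 i = 0) ∧ ‖M‖ ≤ C ∧
      ∀ i, a i ^ 2 * |M.2.2 i| ≤ 4 * dist (z k).1 a ^ 2 * C := by
    intro k
    by_cases hk : KKTReg f g h κ (t k) (z k)
    · obtain ⟨hZ, lam, mu, nu0, nu1, rho, dpl, dmi, hM⟩ := kktReg_iff.1 hk
      refine ⟨(lam, mu, fun i => (dpl i - dmi i) * (z k).2 i), fun _ hd htk => ?_⟩
      have h1 := hC _ _ _ _ _ _ _ _ _ _ (ht0 k) (htk.trans_le (min_le_left _ _))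
        (hd.trans_le (min_le_left _ _)) hZ zero_le_one hM
      rw [mul_one] at h1
      have h2 := hG _ _ _ _ _ _ _ _ _ _ (ht0 k) (htk.trans_le (min_le_right _ _))
        (hd.trans_le (min_le_right _ _)) hZ hM
      obtain ⟨c1, -, c3, -, -, -, -, -, c9, -⟩ := hM
      refine ⟨⟨by simpa only [one_mul] using c1, c3, c9⟩, h1, fun i => (h2 i).trans ?_⟩
      gcongr
      refine le_trans ?_ h1
      simp
    · exact ⟨0, fun h => absurd h hk⟩
  choose M hM using hmult
  have hη : 0 < min η₁ η₂ := lt_min hη₁ hη₂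
  have hev : ∀ᶠ k in U, KKTReg f g h κ (t k) (z k) ∧ dist (z k).1 a < min η₁ η₂ ∧
      t k < min η₁ η₂ :=
    hz.and ((hx.eventually (Metric.ball_mem_nhds a hη)).and (ht.eventually (gt_mem_nhds hη)))
  obtain ⟨N, hN⟩ := exists_tendsto_of_norm_le U (u := M) (C := C)
    (hev.mono fun k hk => (hM k hk.1 hk.2.1 hk.2.2).2.1)
  refine ⟨N.1, N.2.1, N.2.2, isMMult_of_tendsto hf hg hh hx hN
    (hev.mono fun k hk => (hM k hk.1 hk.2.1 hk.2.2).1) fun i hi => ?_⟩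
  have h1 : Tendsto (fun k => a i ^ 2 * |(M k).2.2 i|) U (𝓝 (a i ^ 2 * |N.2.2 i|)) := by
    have hc : Continuous fun M : (Fin m → ℝ) × (Fin p → ℝ) × (Fin n → ℝ) =>
      a i ^ 2 * |M.2.2 i| := by fun_prop
    exact (hc.tendsto N).comp hN
  have h2 : Tendsto (fun k => 4 * dist (z k).1 a ^ 2 * C) U (𝓝 0) := by
    have := (((tendsto_iff_dist_tendsto_zero.1 hx).pow 2).const_mul 4).mul_const C
    simpa using this
  have h3 : a i ^ 2 * |N.2.2 i| ≤ 0 := le_of_tendsto_of_tendsto h1 h2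
    (hev.mono fun k hk => (hM k hk.1 hk.2.1 hk.2.2).2.2 i)
  have h4 : 0 < a i ^ 2 := by positivity
  have h5 : |N.2.2 i| ≤ 0 := by nlinarith [abs_nonneg (N.2.2 i)]
  exact abs_eq_zero.1 (le_antisymm h5 (abs_nonneg _))

/-! ### Isolatedness of M-stationary points -/

lemma taylor_bound {φ : (Fin n → ℝ) → ℝ} (hφ : ContDiff ℝ 2 φ) (a : Fin n → ℝ) :
    ∃ L : ℝ, ∀ᶠ x in 𝓝 a, |φ x - φ a - D1 φ a (x - a)| ≤ L * ‖x - a‖ ^ 2 := by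
  have h1 : HasFDerivAt (fderiv ℝ φ) (fderiv ℝ (fderiv ℝ φ) a) a :=
    ((hφ.fderiv_right (m := 1) (by norm_num)).differentiable one_ne_zero a).hasFDerivAt
  obtain ⟨L, hL, hb⟩ := h1.isBigO_sub.exists_nonneg
  refine ⟨L, ?_⟩
  obtain ⟨δ, hδ, hball⟩ := Metric.eventually_nhds_iff.1 hb.bound
  filter_upwards [Metric.ball_mem_nhds a hδ] with x hx
  have h2 : ∀ w ∈ Metric.closedBall a ‖x - a‖, ‖fderiv ℝ φ w - fderiv ℝ φ a‖ ≤ L * ‖x - a‖ := by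
    intro w hw
    rw [mem_closedBall_iff_norm] at hw
    have h3 : dist w a < δ := by
      rw [dist_eq_norm]
      rw [mem_ball_iff_norm] at hx
      exact hw.trans_lt hx
    exact (hball h3).trans (by gcongr)
  have h4 := Convex.norm_image_sub_le_of_norm_fderiv_le' (𝕜 := ℝ) (y := x)
    (fun w _ => hφ.differentiable two_ne_zero w) h2 (convex_closedBall a _)
    (Metric.mem_closedBall_self (norm_nonneg _)) (by rw [mem_closedBall_iff_norm])
  rw [Real.norm_eq_abs] at h4
  calc |φ x - φ a - D1 φ a (x - a)| ≤ L * ‖x - a‖ * ‖x - a‖ := h4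
    _ = L * ‖x - a‖ ^ 2 := by ring

lemma tendsto_first_order {φ : (Fin n → ℝ) → ℝ} (hφ : ContDiff ℝ 2 φ) {a d : Fin n → ℝ}
    {U : Filter (Fin n → ℝ)} (hU : U ≤ 𝓝[≠] a)
    (hd : Tendsto (fun x => ‖x - a‖⁻¹ • (x - a)) U (𝓝 d)) :
    Tendsto (fun x => ‖x - a‖⁻¹ * (φ x - φ a)) U (𝓝 (D1 φ a d)) := by
  have h1 := ((hφ.differentiable two_ne_zero a).hasFDerivAt.hasFDerivWithinAt
    (s := Set.univ)).lim (α := Fin n → ℝ) (l := U) (c := fun x => ‖x - a‖⁻¹) (d := fun x => x - a)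
    (v := d) (by
      have : Tendsto (fun x => x) U (𝓝[≠] a) := hU
      exact tendsto_sub_nhds_zero_iff.2 (this.mono_right nhdsWithin_le_nhds))
    (by simp) hd
  simpa [D1] using h1

lemma tendsto_second_order {φ : (Fin n → ℝ) → ℝ} (hφ : ContDiff ℝ 2 φ) {a d : Fin n → ℝ}
    {U : Filter (Fin n → ℝ)} (hU : U ≤ 𝓝[≠] a)
    (hd : Tendsto (fun x => ‖x - a‖⁻¹ • (x - a)) U (𝓝 d)) :
    Tendsto (fun x => (‖x - a‖⁻¹) ^ 2 * (D1 φ x (x - a) - D1 φ a (x - a))) U (𝓝 (D2 φ a d)) := by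
  have h1 : HasFDerivAt (fderiv ℝ φ) (fderiv ℝ (fderiv ℝ φ) a) a :=
    ((hφ.fderiv_right (m := 1) (by norm_num)).differentiable one_ne_zero a).hasFDerivAt
  have h2 := (h1.hasFDerivWithinAt
    (s := Set.univ)).lim (α := Fin n → ℝ) (l := U) (c := fun x => ‖x - a‖⁻¹) (d := fun x => x - a)
    (v := d) (by
      have : Tendsto (fun x => x) U (𝓝[≠] a) := hU
      exact tendsto_sub_nhds_zero_iff.2 (this.mono_right nhdsWithin_le_nhds))
    (by simp) hd
  have h3 := ((isBoundedBilinearMap_apply (𝕜 := ℝ) (E := Fin n → ℝ) (F := ℝ)).continuous.tendsto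
    (fderiv ℝ (fderiv ℝ φ) a d, d)).comp (h2.prodMk_nhds hd)
  rw [show D2 φ a d = fderiv ℝ (fderiv ℝ φ) a d d by simp [D2, iteratedFDeriv_two_apply]]
  refine h3.congr fun x => ?_
  simp only [Function.comp_apply, add_sub_cancel, _root_.smul_apply, _root_.sub_apply, map_smul, smul_eq_mul, D1]
  ring

/-- Under CC-MFCQ and the second-order condition, M-stationary points are isolated. -/
lemma eventually_eq_of_isMMult (hf : ContDiff ℝ 2 f)
    (hg : ∀ i, ContDiff ℝ 2 (fun x => g x i)) (hh : ∀ i, ContDiff ℝ 2 (fun x => h x i)) {κ : ℕ}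
    {a : Fin n → ℝ} (haf : CCPFeasible g h κ a) (ha : CCMFCQ g h a)
    (hsoc : ∀ (lam : Fin m → ℝ) (mu : Fin p → ℝ) (gam : Fin n → ℝ),
      IsMMult f g h a lam mu gam →
      ∀ dx : Fin n → ℝ, CritConeX f g h κ a dx → dx ≠ 0 →
        0 < D2 f a dx + ∑ i, lam i * D2 (fun x' => g x' i) a dx
        + ∑ i, mu i * D2 (fun x' => h x' i) a dx) :
    ∀ᶠ x in 𝓝 a, CCPFeasible g h κ x → (∃ lam mu gam, IsMMult f g h x lam mu gam) → x = a := by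
  by_contra hcon
  have hne := frequently_iff_neBot.1 (not_eventually.1 hcon)
  obtain ⟨U, hU⟩ := exists_ultrafilter_iff.2 hne
  have hUa : (U : Filter (Fin n → ℝ)) ≤ 𝓝 a := hU.trans inf_le_left
  have hUP := le_principal_iff.1 (hU.trans inf_le_right)
  have hex : ∀ᶠ x : Fin n → ℝ in U, x ≠ a ∧ CCPFeasible g h κ x ∧
      ∃ M : (Fin m → ℝ) × (Fin p → ℝ) × (Fin n → ℝ), IsMMult f g h x M.1 M.2.1 M.2.2 := by
    filter_upwards [hUP] with x hx
    simp only [Classical.not_imp] at hx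
    obtain ⟨h1, ⟨lam, mu, gam, h2⟩, h3⟩ := hx
    exact ⟨h3, h1, (lam, mu, gam), h2⟩
  have hchoice : ∀ x, ∃ M : (Fin m → ℝ) × (Fin p → ℝ) × (Fin n → ℝ),
      (∃ M' : (Fin m → ℝ) × (Fin p → ℝ) × (Fin n → ℝ), IsMMult f g h x M'.1 M'.2.1 M'.2.2) →
      IsMMult f g h x M.1 M.2.1 M.2.2 := fun x => by
    by_cases hx : ∃ M' : (Fin m → ℝ) × (Fin p → ℝ) × (Fin n → ℝ),
      IsMMult f g h x M'.1 M'.2.1 M'.2.2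
    · obtain ⟨M, hM⟩ := hx
      exact ⟨M, fun _ => hM⟩
    · exact ⟨0, fun h => absurd h hx⟩
  choose M hM using hchoice
  have hev : ∀ᶠ x : Fin n → ℝ in U, x ≠ a ∧ CCPFeasible g h κ x ∧ IsMMult f g h x (M x).1 (M x).2.1 (M x).2.2 :=
    hex.mono fun x hx => ⟨hx.1, hx.2.1, hM x hx.2.2⟩
  have hUne : (U : Filter (Fin n → ℝ)) ≤ 𝓝[≠] a :=
    le_inf hUa (le_principal_iff.2 (hev.mono fun x hx => hx.1))
  have hid : Tendsto (fun x => x) (U : Filter (Fin n → ℝ)) (𝓝 a) := hUa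
  have hsupp : ∀ᶠ x : Fin n → ℝ in U, ∀ i, x i = 0 → a i = 0 := by
    refine hUa (eventually_all.2 fun i => ?_)
    by_cases hi : a i = 0
    · simp [hi]
    · filter_upwards [((continuous_apply i).tendsto a).eventually (isOpen_ne.mem_nhds hi)]
        with x hx hx0 using absurd hx0 hx
  -- the multipliers converge along `U`
  obtain ⟨c, hc, hcb⟩ := exists_multiplier_bound hg hh ha
  obtain ⟨B, hB0, hB⟩ := eventually_norm_fderiv_le hf a
  obtain ⟨N, hN⟩ : ∃ N, Tendsto M U (𝓝 N) := by
    refine exists_tendsto_of_norm_le U (C := B / c) ?_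
    filter_upwards [hev, hUa hcb, hUa hB, hsupp] with x ⟨_, _, hx⟩ hxc hxB hxs
    have h1 := hxc (M x) hx.2.1 hx.2.2.1
    have h2 : ∑ i, a i ^ 2 * |(M x).2.2 i| = 0 := Finset.sum_eq_zero fun i _ => by
      by_cases hi : x i = 0
      · simp [hxs i hi]
      · simp [hx.2.2.2 i hi]
    have h3 := multFunctional_eq_neg_smul (f := f) (g := g) (h := h) (x := x) (s := 1)
      (lam := (M x).1) (mu := (M x).2.1) (gam := (M x).2.2) (by simpa only [one_mul] using hx.1)
    rw [h2, add_zero, h3, one_smul, norm_neg] at h1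
    rw [le_div_iff₀ hc]
    linarith
  have hN1 : ∀ i, Tendsto (fun x => (M x).1 i) U (𝓝 (N.1 i)) := fun i =>
    (((continuous_apply i).comp continuous_fst).tendsto N).comp hN
  have hN2 : ∀ i, Tendsto (fun x => (M x).2.1 i) U (𝓝 (N.2.1 i)) := fun i =>
    (((continuous_apply i).comp (continuous_fst.comp continuous_snd)).tendsto N).comp hN
  have hN3 : ∀ i, Tendsto (fun x => (M x).2.2 i) U (𝓝 (N.2.2 i)) := fun i =>
    (((continuous_apply i).comp (continuous_snd.comp continuous_snd)).tendsto N).comp hN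
  have hlamg : ∀ i, N.1 i ≠ 0 → ∀ᶠ x : Fin n → ℝ in U, g x i = 0 := fun i hi => by
    filter_upwards [hev, (hN1 i).eventually (isOpen_ne.mem_nhds hi)] with x hx hx1
    exact (mul_eq_zero.1 (hx.2.2.2.2.1 i)).resolve_left hx1
  have hgamx : ∀ i, N.2.2 i ≠ 0 → ∀ᶠ x : Fin n → ℝ in U, x i = 0 := fun i hi => by
    filter_upwards [hev, (hN3 i).eventually (isOpen_ne.mem_nhds hi)] with x hx hx1
    by_contra hxi
    exact hx1 (hx.2.2.2.2.2 i hxi)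
  have hgamx' : ∀ i, N.2.2 i ≠ 0 → a i = 0 := fun i hi => by
    obtain ⟨x, hx1, hx2⟩ := ((hgamx i hi).and hsupp).exists
    exact hx2 i hx1
  have hMN : IsMMult f g h a N.1 N.2.1 N.2.2 :=
    isMMult_of_tendsto hf hg hh hid hN (hev.mono fun x hx => ⟨hx.2.2.1, hx.2.2.2.1, hx.2.2.2.2.1⟩)
      fun i hi => by
        by_contra h0
        exact hi (hgamx' i h0)
  -- the normalized directions converge along `U`
  obtain ⟨d, hd1, hd⟩ := exists_tendsto_of_eventually_mem U
    (isCompact_sphere (0 : Fin n → ℝ) 1) (u := fun x => ‖x - a‖⁻¹ • (x - a)) (by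
      filter_upwards [hev] with x hx
      have : ‖x - a‖ ≠ 0 := norm_ne_zero_iff.2 (sub_ne_zero.2 hx.1)
      simp [norm_smul, this])
  have hd0 : d ≠ 0 := by
    rintro rfl
    simp at hd1
  have hdi : ∀ i, (∀ᶠ x : Fin n → ℝ in U, x i = 0) → a i = 0 ∧ d i = 0 := fun i hi => by
    obtain ⟨x, hx1, hx2⟩ := (hi.and hsupp).exists
    have hai := hx2 i hx1
    refine ⟨hai, tendsto_nhds_unique (((continuous_apply i).tendsto d).comp hd)
      (tendsto_const_nhds.congr' ?_)⟩
    filter_upwards [hi] with x hx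
    simp [hx, hai]
  have hgd : ∀ i, g a i = 0 → D1 (fun x' => g x' i) a d ≤ 0 := fun i hi => by
    refine le_of_tendsto (tendsto_first_order (hg i) hUne hd) ?_
    filter_upwards [hev] with x hx
    rw [hi, sub_zero]
    exact mul_nonpos_of_nonneg_of_nonpos (by positivity) (hx.2.1.1 i)
  have hgd0 : ∀ i, N.1 i * D1 (fun x' => g x' i) a d = 0 := fun i => by
    by_cases hi : N.1 i = 0
    · simp [hi]
    · have h0 := (mul_eq_zero.1 (hMN.2.2.1 i)).resolve_left hi
      have : D1 (fun x' => g x' i) a d = 0 := by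
        refine tendsto_nhds_unique (tendsto_first_order (hg i) hUne hd)
          (tendsto_const_nhds.congr' ?_)
        filter_upwards [hlamg i hi] with x hx
        simp [hx, h0]
      simp [this]
  have hhd : ∀ i, D1 (fun x' => h x' i) a d = 0 := fun i => by
    refine tendsto_nhds_unique (tendsto_first_order (hh i) hUne hd)
      (tendsto_const_nhds.congr' ?_)
    filter_upwards [hev] with x hx
    simp [hx.2.1.2.1 i, haf.2.1 i]
  have hcrit : CritConeX f g h κ a d := by
    refine ⟨hgd, hhd, ?_, ?_⟩
    · have hall : ∀ᶠ x : Fin n → ℝ in U, ∀ i, x i = 0 → a i = 0 ∧ d i = 0 := by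
        refine eventually_all.2 fun i => ?_
        by_cases hi : ∀ᶠ x : Fin n → ℝ in U, x i = 0
        · exact Eventually.of_forall fun _ _ => hdi i hi
        · exact (Ultrafilter.eventually_not.2 hi).mono fun x hx hx0 => absurd hx0 hx
      obtain ⟨x, hx, hxa⟩ := (hev.and hall).exists
      have h1 := ncard_eq_zero_add_card0 x
      have h2 := hx.2.1.2.2
      have h3 : {i | x i = 0}.ncard ≤ {i | a i = 0 ∧ d i = 0}.ncard :=
        Set.ncard_le_ncard (fun i hi => hxa i hi) (Set.toFinite _)
      omega
    · have h1 := hMN.1 d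
      have h2 : ∑ i, N.2.2 i * d i = 0 := Finset.sum_eq_zero fun i _ => by
        by_cases hi : N.2.2 i = 0
        · simp [hi]
        · simp [(hdi i (hgamx i hi)).2]
      rw [h2, Finset.sum_eq_zero fun i _ => hgd0 i,
        Finset.sum_eq_zero fun i _ => by rw [hhd i, mul_zero]] at h1
      linarith
  have hpos := hsoc _ _ _ hMN d hcrit hd0
  -- expansion of the Lagrangian gradient
  have hquad : Tendsto (fun x => (‖x - a‖⁻¹) ^ 2 * (D1 f x (x - a) - D1 f a (x - a))
      + ∑ i, (M x).1 i * ((‖x - a‖⁻¹) ^ 2 *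
        (D1 (fun x' => g x' i) x (x - a) - D1 (fun x' => g x' i) a (x - a)))
      + ∑ i, (M x).2.1 i * ((‖x - a‖⁻¹) ^ 2 *
        (D1 (fun x' => h x' i) x (x - a) - D1 (fun x' => h x' i) a (x - a)))) U
      (𝓝 (D2 f a d + ∑ i, N.1 i * D2 (fun x' => g x' i) a d
        + ∑ i, N.2.1 i * D2 (fun x' => h x' i) a d)) :=
    ((tendsto_second_order hf hUne hd).add
      (tendsto_finsetSum Finset.univ fun i _ =>
        (hN1 i).mul (tendsto_second_order (hg i) hUne hd))).add
      (tendsto_finsetSum Finset.univ fun i _ =>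
        (hN2 i).mul (tendsto_second_order (hh i) hUne hd))
  choose Lg hLg using fun i => taylor_bound (hg i) a
  choose Lh hLh using fun i => taylor_bound (hh i) a
  have herr : Tendsto (fun x => ∑ i, |(M x).1 i - N.1 i| * Lg i
      + ∑ i, |(M x).2.1 i - N.2.1 i| * Lh i) U (𝓝 0) := by
    have h1 : Tendsto (fun x => ∑ i, |(M x).1 i - N.1 i| * Lg i
      + ∑ i, |(M x).2.1 i - N.2.1 i| * Lh i) U
      (𝓝 (∑ i, |N.1 i - N.1 i| * Lg i + ∑ i, |N.2.1 i - N.2.1 i| * Lh i)) :=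
      (tendsto_finsetSum Finset.univ fun i _ => (((hN1 i).sub_const _).abs).mul_const _).add
        (tendsto_finsetSum Finset.univ fun i _ => (((hN2 i).sub_const _).abs).mul_const _)
    simpa using h1
  have hbig := (hquad.sub herr).eventually (lt_mem_nhds (by simpa using hpos))
  have hgamz : ∀ᶠ x : Fin n → ℝ in U, ∀ i, ((M x).2.2 i - N.2.2 i) * (x - a) i = 0 := by
    refine eventually_all.2 fun i => ?_
    by_cases hi : ∀ᶠ x : Fin n → ℝ in U, x i = 0
    · filter_upwards [hi] with x hx
      simp [hx, (hdi i hi).1]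
    · have h0 : N.2.2 i = 0 := by
        by_contra h0
        exact hi (hgamx i h0)
      filter_upwards [hev, Ultrafilter.eventually_not.2 hi] with x hx hx0
      simp [hx.2.2.2.2.2 i hx0, h0]
  have hlamz : ∀ᶠ x : Fin n → ℝ in U, ∀ i, 0 ≤ ((M x).1 i - N.1 i) * (g x i - g a i) := by
    refine Filter.Eventually.mono hev fun x hx i => ?_
    have h1 := hx.2.2.2.2.1 i
    have h2 := hMN.2.2.1 i
    have h3 := mul_nonneg (hx.2.2.2.1 i) (neg_nonneg.2 (haf.1 i))
    have h4 := mul_nonneg (hMN.2.1 i) (neg_nonneg.2 (hx.2.1.1 i))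
    linarith
  obtain ⟨x, hx, hxbig, hxgam, hxlam, hxg, hxh⟩ := (hev.and (hbig.and (hgamz.and (hlamz.and
    ((eventually_all.2 fun i => hUa (hLg i)).and (eventually_all.2 fun i => hUa (hLh i))))))).exists
  obtain ⟨hxa, hxf, hxM⟩ := hx
  have hr : 0 < ‖x - a‖ := norm_pos_iff.2 (sub_ne_zero.2 hxa)
  have e1 := hxM.1 (x - a)
  have e2 := hMN.1 (x - a)
  have e3 : ∑ i, (M x).2.2 i * (x - a) i = ∑ i, N.2.2 i * (x - a) i :=
    Finset.sum_congr rfl fun i _ => by linarith [hxgam i]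
  have e4 : ∀ i, -(|(M x).1 i - N.1 i| * Lg i) * ‖x - a‖ ^ 2 ≤
      ((M x).1 i - N.1 i) * D1 (fun x' => g x' i) a (x - a) := fun i => by
    have h1 := hxlam i
    have h2 : |((M x).1 i - N.1 i) * (g x i - g a i - D1 (fun x' => g x' i) a (x - a))| ≤
        |(M x).1 i - N.1 i| * (Lg i * ‖x - a‖ ^ 2) := by
      rw [abs_mul]
      gcongr
      exact hxg i
    have h3 := (abs_le.1 h2).2
    linarith
  have e5 : ∀ i, -(|(M x).2.1 i - N.2.1 i| * Lh i) * ‖x - a‖ ^ 2 ≤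
      ((M x).2.1 i - N.2.1 i) * D1 (fun x' => h x' i) a (x - a) := fun i => by
    have h2 : |((M x).2.1 i - N.2.1 i) * (h x i - h a i - D1 (fun x' => h x' i) a (x - a))| ≤
        |(M x).2.1 i - N.2.1 i| * (Lh i * ‖x - a‖ ^ 2) := by
      rw [abs_mul]
      gcongr
      exact hxh i
    rw [hxf.2.1 i, haf.2.1 i] at h2
    have h3 := (abs_le.1 h2).2
    linarith
  have e6 := Finset.sum_le_sum fun i (_ : i ∈ Finset.univ) => e4 i
  have e7 := Finset.sum_le_sum fun i (_ : i ∈ Finset.univ) => e5 i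
  have hscaled := mul_pos (pow_pos hr 2) hxbig
  have hcancel : ∀ v : ℝ, ‖x - a‖ ^ 2 * ((‖x - a‖⁻¹) ^ 2 * v) = v := fun v => by
    field_simp
  have hcancel' : ∀ u v : ℝ, ‖x - a‖ ^ 2 * (u * ((‖x - a‖⁻¹) ^ 2 * v)) = u * v := fun u v => by
    field_simp
  simp only [mul_sub (‖x - a‖ ^ 2), mul_add (‖x - a‖ ^ 2), Finset.mul_sum, hcancel, hcancel']
    at hscaled
  simp only [mul_sub, sub_mul, Finset.sum_sub_distrib] at hscaled e6 e7
  have e8 : ∑ i, ‖x - a‖ ^ 2 * (|(M x).1 i - N.1 i| * Lg i) =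
      -∑ i, -(|(M x).1 i - N.1 i| * Lg i) * ‖x - a‖ ^ 2 := by
    rw [← Finset.sum_neg_distrib]
    exact Finset.sum_congr rfl fun i _ => by ring
  have e9 : ∑ i, ‖x - a‖ ^ 2 * (|(M x).2.1 i - N.2.1 i| * Lh i) =
      -∑ i, -(|(M x).2.1 i - N.2.1 i| * Lh i) * ‖x - a‖ ^ 2 := by
    rw [← Finset.sum_neg_distrib]
    exact Finset.sum_congr rfl fun i _ => by ring
  rw [e8, e9] at hscaled
  linarith

/-! ### Localization of the regularized programs -/

lemma isClosed_ZReg (hg : ∀ i, Continuous fun x => g x i) (hh : ∀ i, Continuous fun x => h x i)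
    (κ : ℕ) (t : ℝ) : IsClosed (ZReg g h κ t) := by
  have h1 : ∀ i, Continuous fun z : (Fin n → ℝ) × (Fin n → ℝ) => z.1 i := fun i => by fun_prop
  have h2 : ∀ i, Continuous fun z : (Fin n → ℝ) × (Fin n → ℝ) => z.2 i := fun i => by fun_prop
  have e : ZReg g h κ t = (⋂ i, {z | g z.1 i ≤ 0}) ∩ ((⋂ i, {z | h z.1 i = 0}) ∩
      ((⋂ i, {z | 0 ≤ z.2 i}) ∩ ((⋂ i, {z | z.2 i ≤ 1}) ∩
      ({z | (n : ℝ) - (κ : ℝ) ≤ ∑ i, z.2 i} ∩ ((⋂ i, {z | z.1 i * z.2 i ≤ t}) ∩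
      (⋂ i, {z | -t ≤ z.1 i * z.2 i})))))) := by
    ext z
    simp [ZReg]
  rw [e]
  refine (isClosed_iInter fun i => isClosed_le ((hg i).comp continuous_fst) continuous_const).inter
    ((isClosed_iInter fun i => isClosed_eq ((hh i).comp continuous_fst) continuous_const).inter
    ((isClosed_iInter fun i => isClosed_le continuous_const (h2 i)).inter
    ((isClosed_iInter fun i => isClosed_le (h2 i) continuous_const).inter
    ((isClosed_le continuous_const (continuous_finsetSum _ fun i _ => h2 i)).inter
    ((isClosed_iInter fun i => isClosed_le ((h1 i).mul (h2 i)) continuous_const).inter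
    (isClosed_iInter fun i => isClosed_le continuous_const ((h1 i).mul (h2 i))))))))

lemma mem_prod_of_mem_ZReg {κ : ℕ} {t r : ℝ} {a : Fin n → ℝ} {z : (Fin n → ℝ) × (Fin n → ℝ)}
    (hz : z ∈ ZReg g h κ t) (hd : dist z.1 a ≤ r) :
    z ∈ Metric.closedBall a r ×ˢ Set.Icc (0 : Fin n → ℝ) 1 :=
  ⟨hd, hz.2.2.1, hz.2.2.2.1⟩

lemma isCompact_closedBall_prod_Icc (a : Fin n → ℝ) (r : ℝ) :
    IsCompact (Metric.closedBall a r ×ˢ Set.Icc (0 : Fin n → ℝ) 1) :=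
  (isCompact_closedBall a r).prod isCompact_Icc

/-- Constrained minimizers of the regularized programs near a strict local minimum
converge to it. -/
lemma tendsto_of_isMinOn_ZReg (hf : Continuous f) (hg : ∀ i, Continuous fun x => g x i)
    (hh : ∀ i, Continuous fun x => h x i) {κ : ℕ} {a : Fin n → ℝ}
    (ha : CCPFeasible g h κ a) {r : ℝ} (hr : 0 ≤ r)
    (hmin : ∀ x, CCPFeasible g h κ x → dist x a ≤ r → x ≠ a → f a < f x)
    {t : ℕ → ℝ} (ht0 : ∀ k, 0 < t k) (ht : Tendsto t atTop (𝓝 0))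
    {z : ℕ → (Fin n → ℝ) × (Fin n → ℝ)} (hz : ∀ k, z k ∈ ZReg g h κ (t k))
    (hzr : ∀ k, dist (z k).1 a ≤ r)
    (hzmin : ∀ k, ∀ w ∈ ZReg g h κ (t k), dist w.1 a ≤ r → f (z k).1 ≤ f w.1) :
    Tendsto (fun k => (z k).1) atTop (𝓝 a) := by
  rw [tendsto_iff_ultrafilter]
  intro U hU
  obtain ⟨w, hw, hzw⟩ := exists_tendsto_of_eventually_mem U (isCompact_closedBall_prod_Icc a r)
    (Eventually.of_forall fun k => mem_prod_of_mem_ZReg (hz k) (hzr k))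
  have hx : Tendsto (fun k => (z k).1) U (𝓝 w.1) := (continuous_fst.tendsto w).comp hzw
  have hfeas := ccpFeasible_of_mem_ZSet
    (mem_ZSet_of_tendsto hg hh (ht.mono_left hU) (Eventually.of_forall hz) hzw)
  have hle : f w.1 ≤ f a :=
    le_of_tendsto ((hf.tendsto w.1).comp hx) <| Eventually.of_forall fun k => by
      obtain ⟨y, hy⟩ := exists_mem_ZReg ha (ht0 k).le
      exact hzmin k _ hy (by simpa using hr)
  have hwa : w.1 = a := by
    by_contra hne
    exact (hmin _ hfeas hw.1 hne).not_ge hle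
  rwa [hwa] at hx

lemma exists_isMinOn_ZReg (hf : Continuous f) (hg : ∀ i, Continuous fun x => g x i)
    (hh : ∀ i, Continuous fun x => h x i) {κ : ℕ} {a : Fin n → ℝ}
    (ha : CCPFeasible g h κ a) {r t : ℝ} (hr : 0 ≤ r) (ht : 0 ≤ t) :
    ∃ z ∈ ZReg g h κ t, dist z.1 a ≤ r ∧
      ∀ w ∈ ZReg g h κ t, dist w.1 a ≤ r → f z.1 ≤ f w.1 := by
  have hK := (isCompact_closedBall_prod_Icc a r).inter_right (isClosed_ZReg hg hh κ t)
  obtain ⟨y, hy⟩ := exists_mem_ZReg ha ht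
  obtain ⟨z, hz, hzmin⟩ := hK.exists_isMinOn
    ⟨_, mem_prod_of_mem_ZReg (a := a) (r := r) hy (by simpa using hr), hy⟩
    (hf.comp continuous_fst).continuousOn
  exact ⟨z, hz.2, hz.1.1, fun w hw hwr => hzmin ⟨mem_prod_of_mem_ZReg hw hwr, hw⟩⟩

lemma tendsto_of_kktReg (hf : ContDiff ℝ 2 f)
    (hg : ∀ i, ContDiff ℝ 2 (fun x => g x i)) (hh : ∀ i, ContDiff ℝ 2 (fun x => h x i)) {κ : ℕ}
    (hκn : κ ≤ n) {a : Fin n → ℝ} {r : ℝ}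
    (hcq : ∀ x, dist x a ≤ r → CCMFCQ g h x)
    (hiso : ∀ x, dist x a ≤ r → CCPFeasible g h κ x →
      (∃ lam mu gam, IsMMult f g h x lam mu gam) → x = a)
    {t : ℕ → ℝ} (ht0 : ∀ k, 0 < t k) (ht : Tendsto t atTop (𝓝 0))
    {z : ℕ → (Fin n → ℝ) × (Fin n → ℝ)}
    (hz : ∀ᶠ k in atTop, KKTReg f g h κ (t k) (z k) ∧ dist (z k).1 a < r) :
    Tendsto (fun k => (z k).1) atTop (𝓝 a) := by
  rw [tendsto_iff_ultrafilter]
  intro U hU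
  have hzU := hU hz
  obtain ⟨w, hw, hzw⟩ := exists_tendsto_of_eventually_mem U (isCompact_closedBall_prod_Icc a r)
    (Filter.Eventually.mono hzU fun k hk => mem_prod_of_mem_ZReg hk.1.1 hk.2.le)
  have hx : Tendsto (fun k => (z k).1) U (𝓝 w.1) := (continuous_fst.tendsto w).comp hzw
  have hfeas := ccpFeasible_of_mem_ZSet
    (mem_ZSet_of_tendsto (fun i => (hg i).continuous) (fun i => (hh i).continuous)
      (ht.mono_left hU) (Filter.Eventually.mono hzU fun k hk => hk.1.1) hzw)
  have hM := exists_isMMult_of_tendsto_kktReg hf hg hh hκn U ht0 (ht.mono_left hU)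
    (Filter.Eventually.mono hzU fun k hk => hk.1) hx (hcq _ hw.1)
  rwa [hiso _ hw.1 hfeas hM] at hx
end

theorem stmt16
    {n m p : ℕ} (f : (Fin n → ℝ) → ℝ) (g : (Fin n → ℝ) → Fin m → ℝ)
    (h : (Fin n → ℝ) → Fin p → ℝ) (κ : ℕ)
    (hn : 0 < n) (hm : 0 < m) (hp : 0 < p) (hκ0 : 0 < κ) (hκn : κ < n)
    (hf : ContDiff ℝ 2 f) (hg : ∀ i, ContDiff ℝ 2 (fun x => g x i))
    (hh : ∀ i, ContDiff ℝ 2 (fun x => h x i))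
    (xs : Fin n → ℝ) (hmin : StrictLocalMinCCP f g h κ xs) (hmfcq : CCMFCQ g h xs)
    (hsoc : ∀ (lam : Fin m → ℝ) (mu : Fin p → ℝ) (gam : Fin n → ℝ),
      IsMMult f g h xs lam mu gam →
      ∀ dx : Fin n → ℝ, CritConeX f g h κ xs dx → dx ≠ 0 →
        0 < D2 f xs dx + ∑ i, lam i * D2 (fun x' => g x' i) xs dx
        + ∑ i, mu i * D2 (fun x' => h x' i) xs dx) :
    ∃ r > (0 : ℝ), ∀ t : ℕ → ℝ, (∀ k, 0 < t k) → Tendsto t atTop (nhds 0) →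
      (∀ᶠ k in atTop, ∃ z : (Fin n → ℝ) × (Fin n → ℝ),
        KKTReg f g h κ (t k) z ∧ dist z.1 xs < r) ∧
      ∀ z : ℕ → (Fin n → ℝ) × (Fin n → ℝ),
        (∀ᶠ k in atTop, KKTReg f g h κ (t k) (z k) ∧ dist (z k).1 xs < r) →
        Tendsto (fun k => (z k).1) atTop (nhds xs) := by
  obtain ⟨hfeas, r₀, hr₀, hstrict⟩ := hmin
  obtain ⟨r, hr, hball⟩ := Metric.nhds_basis_closedBall.eventually_iff.1
    ((eventually_CCMFCQ hg hh hmfcq).and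
      ((eventually_eq_of_isMMult hf hg hh hfeas hmfcq hsoc).and (Metric.ball_mem_nhds xs hr₀)))
  obtain ⟨η, hη, hkkt⟩ := exists_kktReg_of_isLocalMinOn hf hg hh hκ0 hκn hmfcq
  refine ⟨r, hr, fun t ht0 ht => ⟨?_, fun z hz => ?_⟩⟩
  · choose z hz hzr hzmin using fun k => exists_isMinOn_ZReg hf.continuous
      (fun i => (hg i).continuous) (fun i => (hh i).continuous) hfeas hr.le (ht0 k).le
    have hlim := tendsto_of_isMinOn_ZReg hf.continuous (fun i => (hg i).continuous)
      (fun i => (hh i).continuous) hfeas hr.le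
      (fun x hx hxr hne => hstrict x hx (hball hxr).2.2 hne) ht0 ht hz hzr hzmin
    filter_upwards [hlim.eventually (Metric.ball_mem_nhds xs (lt_min hr hη)),
      ht.eventually (gt_mem_nhds hη)] with k hk htk
    have hkr : dist (z k).1 xs < r := hk.trans_le (min_le_left _ _)
    refine ⟨z k, hkkt _ _ (ht0 k) htk (hk.trans_le (min_le_right _ _)) (hz k) ?_, hkr⟩
    have hnear : ∀ᶠ w in 𝓝 (z k), dist w.1 xs < r :=
      (continuous_fst.dist continuous_const).continuousAt.eventually (gt_mem_nhds hkr)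
    filter_upwards [nhdsWithin_le_nhds hnear, self_mem_nhdsWithin] with w hwr hw
    exact hzmin k w hw hwr.le
  · exact tendsto_of_kktReg hf hg hh hκn.le (fun x hx => (hball hx).1)
      (fun x hx => (hball hx).2.1) ht0 ht hz
end
end

section
/- If (x*, y*) is a strict local minimum of the continuous reformulation with respect to x and ‖x*‖₀ = κ, then x* is a strict local minimum of the cardinality constrained problem (CCP). -/
open Set Filter Topology

noncomputable section

lemma eventually_support_subset {n : ℕ} (x : Fin n → ℝ) :
    ∀ᶠ x' in 𝓝 x, {i | x i ≠ 0} ⊆ {i | x' i ≠ 0} := by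
  have key : ∀ᶠ x' in 𝓝 x, ∀ i, x i ≠ 0 → x' i ≠ 0 := by
    refine eventually_all.2 fun i => ?_
    by_cases hi : x i = 0
    · simp [hi]
    · filter_upwards [(continuous_apply i).continuousAt.eventually_ne hi] with x' hx' _
      exact hx'
  exact key

theorem stmt17
    {n m p : ℕ} (f : (Fin n → ℝ) → ℝ) (g : (Fin n → ℝ) → Fin m → ℝ)
    (h : (Fin n → ℝ) → Fin p → ℝ) (κ : ℕ)
    (hn : 0 < n) (hm : 0 < m) (hp : 0 < p) (hκ0 : 0 < κ) (hκn : κ < n)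
    (hf : ContDiff ℝ 1 f) (hg : ∀ i, ContDiff ℝ 1 (fun x => g x i))
    (hh : ∀ i, ContDiff ℝ 1 (fun x => h x i))
    (xs ys : Fin n → ℝ) (hmin : StrictLocalMinX f g h κ (xs, ys))
    (hcard : card0 xs = κ) :
    StrictLocalMinCCP f g h κ xs := by
  obtain ⟨⟨hgx, hhx, hy0, hy1, hsum, hxy⟩, r, hr, hlt⟩ := hmin
  obtain ⟨ε, hε, hsupp⟩ := Metric.eventually_nhds_iff.1 (eventually_support_subset xs)
  refine ⟨⟨hgx, hhx, hcard.le⟩, min r ε, lt_min hr hε, ?_⟩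
  rintro x' ⟨hgx', hhx', hcard'⟩ hdist hne
  have heq : {i | xs i ≠ 0} = {i | x' i ≠ 0} :=
    Set.eq_of_subset_of_ncard_le (hsupp (hdist.trans_le (min_le_right r ε)))
      (hcard'.trans hcard.ge)
  refine hlt (x', ys) ⟨hgx', hhx', hy0, hy1, hsum, fun i => ?_⟩ ?_ hne
  · rcases mul_eq_zero.1 (hxy i) with hi | hi
    · have hx'i : x' i = 0 := by
        by_contra hc
        exact (heq.symm.subset hc : xs i ≠ 0) hi
      simp [hx'i]
    · exact mul_eq_zero_of_right _ hi
  · simpa [Prod.dist_eq, hr] using hdist.trans_le (min_le_left r ε)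
end
end

section
/- Let (x*, y*) ∈ Z be a point at which CC-MFCQ holds. Then there exists r > 0 such that CC-MFCQ holds at every point (x, y) ∈ Z with ‖x − x*‖ < r. -/
open Set Filter Topology

noncomputable section

/-- The pairs of a point `x` and a multiplier triple that witness a failure of CC-MFCQ at `x`,
up to the requirement that the triple be nonzero. -/
def witnessSet {n m p : ℕ} (g : (Fin n → ℝ) → Fin m → ℝ) (h : (Fin n → ℝ) → Fin p → ℝ) :
    Set ((Fin n → ℝ) × ((Fin m → ℝ) × (Fin p → ℝ) × (Fin n → ℝ))) :=
  {q | (∀ i, 0 ≤ q.2.1 i) ∧ (∀ i, q.2.1 i * g q.1 i = 0) ∧ (∀ i, q.2.2.2 i * q.1 i = 0) ∧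
    CombZero g h q.2.1 q.2.2.1 q.2.2.2 q.1}

theorem continuous_D1 {n : ℕ} {φ : (Fin n → ℝ) → ℝ} (hφ : ContDiff ℝ 1 φ) (d : Fin n → ℝ) :
    Continuous fun x => D1 φ x d :=
  (hφ.continuous_fderiv one_ne_zero).clm_apply continuous_const

theorem isClosed_witnessSet {n m p : ℕ} {g : (Fin n → ℝ) → Fin m → ℝ}
    {h : (Fin n → ℝ) → Fin p → ℝ} (hg : ∀ i, ContDiff ℝ 1 (fun x => g x i))
    (hh : ∀ i, ContDiff ℝ 1 (fun x => h x i)) : IsClosed (witnessSet g h) := by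
  have hgc := fun i => (hg i).continuous
  have hg' := fun i d => continuous_D1 (hg i) d
  have hh' := fun i d => continuous_D1 (hh i) d
  simp only [witnessSet, CombZero, ofPred_and, ofPred_forall]
  refine .inter ?_ (.inter ?_ (.inter ?_ ?_))
  · exact isClosed_iInter fun i => isClosed_le continuous_const (by fun_prop)
  · exact isClosed_iInter fun i => isClosed_eq
      (Continuous.mul (by fun_prop) ((hgc i).comp continuous_fst))
      continuous_const
  · exact isClosed_iInter fun i => isClosed_eq (by fun_prop) continuous_const
  · refine isClosed_iInter fun d => isClosed_eq ?_ continuous_const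
    refine ((continuous_finsetSum _ fun i _ => ?_).add
      (continuous_finsetSum _ fun i _ => ?_)).add (by fun_prop)
    · exact Continuous.mul (by fun_prop) ((hg' i d).comp continuous_fst)
    · exact Continuous.mul (by fun_prop) ((hh' i d).comp continuous_fst)

theorem smul_mem_witnessSet {n m p : ℕ} {g : (Fin n → ℝ) → Fin m → ℝ}
    {h : (Fin n → ℝ) → Fin p → ℝ} {x : Fin n → ℝ}
    {w : (Fin m → ℝ) × (Fin p → ℝ) × (Fin n → ℝ)} {c : ℝ} (hc : 0 ≤ c)
    (hw : (x, w) ∈ witnessSet g h) : (x, c • w) ∈ witnessSet g h := by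
  obtain ⟨h1, h2, h3, h4⟩ := hw
  refine ⟨fun i => mul_nonneg hc (h1 i), fun i => ?_, fun i => ?_, fun d => ?_⟩
  · simpa [mul_assoc] using Or.inr (mul_eq_zero.mp (h2 i))
  · simpa [mul_assoc] using Or.inr (mul_eq_zero.mp (h3 i))
  · simpa [mul_assoc, ← Finset.mul_sum, ← mul_add] using Or.inr (h4 d)

theorem ccmfcq_iff_witnessSet {n m p : ℕ} {g : (Fin n → ℝ) → Fin m → ℝ}
    {h : (Fin n → ℝ) → Fin p → ℝ} {x : Fin n → ℝ} :
    CCMFCQ g h x ↔ ∀ w, (x, w) ∈ witnessSet g h → w = 0 := by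
  simp only [CCMFCQ, witnessSet, CombZero, Prod.forall, mem_ofPred_eq, Prod.mk_eq_zero, and_imp,
    mul_eq_zero, or_iff_not_imp_right, ne_eq]

/-- CC-MFCQ at `x` only needs to be tested against multiplier triples of norm one. -/
theorem ccmfcq_iff_sphere {n m p : ℕ} {g : (Fin n → ℝ) → Fin m → ℝ}
    {h : (Fin n → ℝ) → Fin p → ℝ} {x : Fin n → ℝ} :
    CCMFCQ g h x ↔ ∀ w ∈ Metric.sphere 0 1, (x, w) ∉ witnessSet g h := by
  rw [ccmfcq_iff_witnessSet]
  refine ⟨fun H w hw hmem => ?_, fun H w hmem => ?_⟩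
  · simp [H w hmem] at hw
  · by_contra hne
    refine H (‖w‖⁻¹ • w) ?_ (smul_mem_witnessSet (inv_nonneg.mpr (norm_nonneg w)) hmem)
    rw [mem_sphere_zero_iff_norm, norm_smul, norm_inv, norm_norm,
      inv_mul_cancel₀ (norm_ne_zero_iff.mpr hne)]

theorem CCMFCQ.eventually {n m p : ℕ} {g : (Fin n → ℝ) → Fin m → ℝ}
    {h : (Fin n → ℝ) → Fin p → ℝ} (hg : ∀ i, ContDiff ℝ 1 (fun x => g x i))
    (hh : ∀ i, ContDiff ℝ 1 (fun x => h x i)) {x : Fin n → ℝ} (hx : CCMFCQ g h x) :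
    ∀ᶠ x' in 𝓝 x, CCMFCQ g h x' := by
  simp only [ccmfcq_iff_sphere] at hx ⊢
  exact (isCompact_sphere _ _).eventually_forall_of_forall_eventually fun w hw =>
    (isClosed_witnessSet hg hh).isOpen_compl.mem_nhds (hx w hw)

theorem stmt18
    {n m p : ℕ} (f : (Fin n → ℝ) → ℝ) (g : (Fin n → ℝ) → Fin m → ℝ)
    (h : (Fin n → ℝ) → Fin p → ℝ) (κ : ℕ)
    (hn : 0 < n) (hm : 0 < m) (hp : 0 < p) (hκ0 : 0 < κ) (hκn : κ < n)
    (hf : ContDiff ℝ 1 f) (hg : ∀ i, ContDiff ℝ 1 (fun x => g x i))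
    (hh : ∀ i, ContDiff ℝ 1 (fun x => h x i))
    (xs ys : Fin n → ℝ) (hZ : (xs, ys) ∈ ZSet g h κ) (hmfcq : CCMFCQ g h xs) :
    ∃ r > (0 : ℝ), ∀ z ∈ ZSet g h κ, dist z.1 xs < r → CCMFCQ g h z.1 := by
  obtain ⟨r, hr, H⟩ := Metric.eventually_nhds_iff.mp (hmfcq.eventually hg hh)
  exact ⟨r, hr, fun z _ hz => H hz⟩
end
end

section
/- Let (x*, y*) be feasible for the continuous reformulation and let CC-MFCQ hold at (x*, y*). Then there exist a radius r > 0 and a T > 0 such that for all t ∈ (0, T] the standard Mangasarian–Fromovitz constraint qualification for the nonlinear program NLP(t) holds at every point (x, y) ∈ Z(t) with ‖x − x*‖ < r. -/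
open Set Filter Topology

noncomputable section

/-- Motzkin's transposition theorem for finitely many strict inequalities and equations. -/
theorem exists_forall_eq_zero_forall_neg {E A ι : Type*} [AddCommGroup E] [Module ℝ E]
    [Fintype A] [Fintype ι] (a : A → E →ₗ[ℝ] ℝ) (b : ι → E →ₗ[ℝ] ℝ)
    (hab : ∀ (lam : A → ℝ) (c : ι → ℝ), (∀ j, 0 ≤ lam j) →
      (∀ d, ∑ j, lam j * a j d + ∑ i, c i * b i d = 0) → lam = 0) :
    ∃ d, (∀ i, b i d = 0) ∧ ∀ j, a j d < 0 := by
  classical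
  by_contra! hcon
  let V : Submodule ℝ (A → ℝ) := (⨅ i, LinearMap.ker (b i)).map (LinearMap.pi a)
  have hdisj : Disjoint (Set.pi univ fun _ : A => Iio (0 : ℝ)) (V : Set (A → ℝ)) := by
    rw [Set.disjoint_left]
    rintro _ hu ⟨d, hd, rfl⟩
    obtain ⟨j, hj⟩ := hcon d (by simpa using hd)
    have := hu j (mem_univ j)
    simp only [LinearMap.pi_apply, mem_Iio] at this
    linarith
  obtain ⟨F, u, hFs, hFV⟩ := geometric_hahn_banach_open
    (convex_pi fun _ _ => convex_Iio (0 : ℝ)) (isOpen_set_pi finite_univ fun _ _ => isOpen_Iio)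
    V.convex hdisj
  have hF0 : ∀ v ∈ V, F v = 0 := by
    intro v hv
    by_contra hne
    have := hFV (((u - 1) / F v) • v) (V.smul_mem _ hv)
    rw [map_smul, smul_eq_mul, div_mul_cancel₀ _ hne] at this
    linarith
  have hu0 : u ≤ 0 := by simpa using hFV 0 V.zero_mem
  have hFsum : ∀ v, F v = ∑ j, F (Pi.single j 1) * v j := by
    intro v
    conv_lhs => rw [pi_eq_sum_univ' v]
    simp [mul_comm]
  have hnn : ∀ j, 0 ≤ F (Pi.single j 1) := by
    intro j
    by_contra! hj
    have hS := (hFs (fun _ => -1) (by simp)).trans_le hu0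
    have := hFs ((fun _ => -1) - (F (fun _ => -1) / F (Pi.single j 1)) • Pi.single j 1) (by
      intro k _
      have h1 := div_pos_of_neg_of_neg hS hj
      rcases eq_or_ne k j with rfl | hk
      · simpa using by linarith
      · simp [hk])
    rw [map_sub, map_smul, smul_eq_mul, div_mul_cancel₀ _ hj.ne] at this
    linarith
  have hspan : (∑ j, F (Pi.single j 1) • a j) ∈ Submodule.span ℝ (range b) := by
    refine mem_span_of_iInf_ker_le_ker fun d hd => ?_
    have := hF0 _ (Submodule.mem_map_of_mem hd)
    rw [hFsum] at this
    simpa using this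
  obtain ⟨c, hc⟩ := Submodule.mem_span_range_iff_exists_fun ℝ |>.1 hspan
  have hz := hab (fun j => F (Pi.single j 1)) (fun i => -c i) hnn fun d => by
    have := congrArg (fun φ => φ d) hc
    simp at this
    simp [this]
  have := hFs (fun _ => -1) (by simp)
  rw [hFsum] at this
  simp [fun j => congrFun hz j] at this
  linarith

/-- Linear independence of finitely many functionals gives a right inverse. -/
theorem exists_rightInverse_pi {E ι : Type*} [NormedAddCommGroup E] [NormedSpace ℝ E]
    [Fintype ι] (b : ι → E →L[ℝ] ℝ)
    (hb : ∀ c : ι → ℝ, (∀ d, ∑ i, c i * b i d = 0) → c = 0) :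
    ∃ R : (ι → ℝ) →L[ℝ] E, ∀ v i, b i (R v) = v i := by
  classical
  have htop : LinearMap.range (LinearMap.pi fun i => (b i : E →ₗ[ℝ] ℝ)) = ⊤ := by
    by_contra hne
    obtain ⟨φ, hφ, hle⟩ := Submodule.exists_le_ker_of_lt_top _ (lt_top_iff_ne_top.2 hne)
    have hsum : ∀ v, φ v = ∑ i, φ (Pi.single i 1) * v i := by
      intro v
      conv_lhs => rw [pi_eq_sum_univ' v]
      simp [mul_comm]
    have hc := hb (fun i => φ (Pi.single i 1)) fun d => by
      have := hle (LinearMap.mem_range_self _ d)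
      rw [LinearMap.mem_ker, hsum] at this
      simpa using this
    refine hφ (LinearMap.ext fun v => ?_)
    rw [hsum]
    simp [fun i => congrFun hc i]
  obtain ⟨R, hR⟩ := LinearMap.exists_rightInverse_of_surjective _ htop
  refine ⟨LinearMap.toContinuousLinearMap R, fun v i => ?_⟩
  simpa using congrFun (LinearMap.congr_fun hR v) i

theorem exists_continuousAt_rightInverse {E ι X : Type*} [NormedAddCommGroup E] [NormedSpace ℝ E]
    [Fintype ι] [TopologicalSpace X] {x₀ : X} (b : ι → X → E →L[ℝ] ℝ)
    (hcont : ∀ i, ContinuousAt (b i) x₀)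
    (hb : ∀ c : ι → ℝ, (∀ d, ∑ i, c i * b i x₀ d = 0) → c = 0) :
    ∃ S : X → (ι → ℝ) →L[ℝ] E, ContinuousAt S x₀ ∧ ∀ᶠ x in 𝓝 x₀, ∀ v i, b i x (S x v) = v i := by
  classical
  obtain ⟨R, hR⟩ := exists_rightInverse_pi (fun i => b i x₀) hb
  let M : X → (ι → ℝ) →L[ℝ] (ι → ℝ) := fun x =>
    ∑ i, ((b i x).comp R).smulRight (Pi.single i (1 : ℝ))
  have hMap : ∀ x v i, M x v i = b i x (R v) := by
    intro x v i
    simp [M, Finset.sum_apply, Pi.single_apply]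
  have hM₀ : M x₀ = 1 := by
    ext v i
    simp [hMap, hR]
  have hMc : ContinuousAt M x₀ := by
    refine tendsto_finsetSum _ fun i _ => ?_
    have h1 : ContinuousAt (fun x => (b i x).comp R) x₀ := (hcont i).clm_comp continuousAt_const
    exact ((ContinuousLinearMap.smulRightL ℝ (ι → ℝ) (ι → ℝ)).flip
      (Pi.single i (1 : ℝ))).continuous.continuousAt.comp h1
  refine ⟨fun x => R.comp (Ring.inverse (M x)), ?_, ?_⟩
  · refine continuousAt_const.clm_comp ?_
    have hinv : ContinuousAt Ring.inverse (M x₀) := by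
      rw [hM₀]
      exact NormedRing.inverse_continuousAt 1
    exact hinv.comp hMc
  · have hu : ∀ᶠ x in 𝓝 x₀, IsUnit (M x) :=
      hMc.eventually (Units.isOpen.mem_nhds (by rw [hM₀]; exact isUnit_one))
    filter_upwards [hu] with x hx v i
    have := congrArg (fun T => T v i) (Ring.mul_inverse_cancel _ hx)
    simpa [hMap] using this

theorem eventually_exists_bounded_solution {E A ι X : Type*}
    [NormedAddCommGroup E] [NormedSpace ℝ E] [Fintype A] [Fintype ι] [TopologicalSpace X] {x₀ : X}
    (a : A → X → E →L[ℝ] ℝ) (b : ι → X → E →L[ℝ] ℝ)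
    (ha : ∀ j, ContinuousAt (a j) x₀) (hb : ∀ i, ContinuousAt (b i) x₀)
    (hab : ∀ (lam : A → ℝ) (c : ι → ℝ), (∀ j, 0 ≤ lam j) →
      (∀ d, ∑ j, lam j * a j x₀ d + ∑ i, c i * b i x₀ d = 0) → lam = 0 ∧ c = 0)
    (v : ι → ℝ) :
    ∃ C, ∀ᶠ x in 𝓝 x₀, ∃ d, ‖d‖ ≤ C ∧ (∀ i, b i x d = v i) ∧ ∀ j, a j x d < 0 := by
  obtain ⟨S, hSc, hS⟩ := exists_continuousAt_rightInverse b hb fun c hc =>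
    (hab 0 c (fun _ => le_rfl) (by simpa using hc)).2
  obtain ⟨d₀, hbd, had⟩ := exists_forall_eq_zero_forall_neg (fun j => (a j x₀ : E →ₗ[ℝ] ℝ))
    (fun i => (b i x₀ : E →ₗ[ℝ] ℝ)) fun lam c hl h => (hab lam c hl h).1
  simp only [ContinuousLinearMap.coe_coe] at hbd had
  -- a multiple of `d₀` dominates the particular solution `S x₀ v`
  obtain ⟨N, hN⟩ : ∃ N : ℝ, ∀ j, a j x₀ (S x₀ v + N • d₀) < 0 := by
    have : ∀ j, ∀ᶠ N : ℝ in atTop, a j x₀ (S x₀ v + N • d₀) < 0 := by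
      intro j
      filter_upwards [eventually_gt_atTop (a j x₀ (S x₀ v) / -(a j x₀ d₀))] with N hN
      rw [div_lt_iff₀ (by linarith [had j])] at hN
      simp only [map_add, map_smul, smul_eq_mul]
      linarith
    exact (eventually_all.2 this).exists
  let r : X → ι → ℝ := fun x i => v i - b i x (N • d₀)
  let δ : X → E := fun x => S x (r x) + N • d₀
  have hrc : ContinuousAt r x₀ := continuousAt_pi.2 fun i =>
    continuousAt_const.sub ((hb i).clm_apply continuousAt_const)
  have hδc : ContinuousAt δ x₀ := (hSc.clm_apply hrc).add continuousAt_const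
  have hr₀ : r x₀ = v := by
    ext i
    simp [r, hbd]
  have hneg : ∀ᶠ x in 𝓝 x₀, ∀ j, a j x (δ x) < 0 := by
    refine eventually_all.2 fun j => ?_
    refine ((ha j).clm_apply hδc).eventually_lt continuousAt_const ?_
    simpa [δ, hr₀] using hN j
  refine ⟨‖δ x₀‖ + 1, ?_⟩
  filter_upwards [hS, hneg, hδc.norm.eventually_lt continuousAt_const (lt_add_one ‖δ x₀‖)]
    with x hx hx' hx''
  refine ⟨δ x, hx''.le, fun i => ?_, hx'⟩
  simp only [δ, map_add, hx, r, sub_add_cancel]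

/-- The hypothesis `CCMFCQ` for the continuous families of gradients. -/
theorem CCMFCQ.posLinIndep {n m p : ℕ} {g : (Fin n → ℝ) → Fin m → ℝ}
    {h : (Fin n → ℝ) → Fin p → ℝ} {xs : Fin n → ℝ} (H : CCMFCQ g h xs)
    (lam : {i // g xs i = 0} → ℝ) (c : Fin p ⊕ {i // xs i = 0} → ℝ) (hlam : ∀ j, 0 ≤ lam j)
    (hsum : ∀ d, ∑ j, lam j * D1 (fun x' => g x' j) xs d +
      (∑ i, c (Sum.inl i) * D1 (fun x' => h x' i) xs d + ∑ i, c (Sum.inr i) * d i) = 0) :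
    lam = 0 ∧ c = 0 := by
  classical
  obtain ⟨h1, h2, h3⟩ := H (fun i => if hi : g xs i = 0 then lam ⟨i, hi⟩ else 0)
    (fun i => c (Sum.inl i)) (fun i => if hi : xs i = 0 then c (Sum.inr ⟨i, hi⟩) else 0)
    (fun i => by split_ifs <;> simp [hlam]) (fun i hi => by simp [hi])
    (fun i hi => by simp [hi]) fun d => by
      refine Eq.trans ?_ (hsum d)
      rw [add_assoc]
      congr 1
      · simp only [dite_mul, zero_mul]
        rw [Finset.sum_dite]
        simp only [Finset.sum_const_zero, add_zero]
        refine (Finset.sum_bij' (fun i _ => ⟨i.1, (Finset.mem_filter.1 i.2).2⟩)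
          (fun i _ => ⟨i.1, by simpa using i.2⟩) ?_ ?_ ?_ ?_ ?_) <;> simp
      · congr 1
        simp only [dite_mul, zero_mul]
        rw [Finset.sum_dite]
        simp only [Finset.sum_const_zero, add_zero]
        refine (Finset.sum_bij' (fun i _ => ⟨i.1, (Finset.mem_filter.1 i.2).2⟩)
          (fun i _ => ⟨i.1, by simpa using i.2⟩) ?_ ?_ ?_ ?_ ?_) <;> simp
  constructor
  · ext ⟨i, hi⟩
    simpa [hi] using congrFun h1 i
  · ext (i | ⟨i, hi⟩)
    · simpa using congrFun h2 i
    · simpa [hi] using congrFun h3 i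

theorem CCMFCQ.eventually_exists_direction {n m p : ℕ} {g : (Fin n → ℝ) → Fin m → ℝ}
    {h : (Fin n → ℝ) → Fin p → ℝ} {xs : Fin n → ℝ} (H : CCMFCQ g h xs)
    (hg : ∀ i, ContDiff ℝ 1 (fun x => g x i)) (hh : ∀ i, ContDiff ℝ 1 (fun x => h x i))
    (v : Fin n → ℝ) :
    ∃ C, ∀ᶠ x in 𝓝 xs, ∃ d : Fin n → ℝ, ‖d‖ ≤ C ∧ (∀ i, D1 (fun x' => h x' i) x d = 0) ∧
      (∀ i, g xs i = 0 → D1 (fun x' => g x' i) x d < 0) ∧ ∀ i, xs i = 0 → d i = v i := by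
  classical
  obtain ⟨C, hC⟩ := eventually_exists_bounded_solution (x₀ := xs)
    (fun (j : {i // g xs i = 0}) x => fderiv ℝ (fun x' => g x' j) x)
    (Sum.elim (fun i x => fderiv ℝ (fun x' => h x' i) x)
      (fun (i : {i // xs i = 0}) _ => ContinuousLinearMap.proj i.1))
    (fun j => ((hg j).continuous_fderiv one_ne_zero).continuousAt)
    (by
      rintro (i | i)
      · exact ((hh i).continuous_fderiv one_ne_zero).continuousAt
      · exact continuousAt_const)
    (fun lam c hlam hsum => H.posLinIndep lam c hlam fun d => by
      simpa [D1, Fintype.sum_sum_type] using hsum d)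
    (Sum.elim 0 fun i => v i)
  refine ⟨C, ?_⟩
  filter_upwards [hC] with x ⟨d, hd, hb, ha⟩
  exact ⟨d, hd, fun i => hb (Sum.inl i), fun i hi => ha ⟨i, hi⟩, fun i hi => hb (Sum.inr ⟨i, hi⟩)⟩

theorem CCMFCQ.eventually_equality_linearIndependent {n m p : ℕ} {g : (Fin n → ℝ) → Fin m → ℝ}
    {h : (Fin n → ℝ) → Fin p → ℝ} {xs : Fin n → ℝ} (H : CCMFCQ g h xs)
    (hh : ∀ i, ContDiff ℝ 1 (fun x => h x i)) :
    ∀ᶠ x in 𝓝 xs, ∀ mu : Fin p → ℝ,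
      (∀ d, ∑ i, mu i * D1 (fun x' => h x' i) x d = 0) → mu = 0 := by
  obtain ⟨S, -, hS⟩ := exists_continuousAt_rightInverse (x₀ := xs)
    (fun i x => fderiv ℝ (fun x' => h x' i) x)
    (fun i => ((hh i).continuous_fderiv one_ne_zero).continuousAt) fun c hc =>
      (H 0 c 0 (fun _ => le_rfl) (fun _ _ => rfl) (fun _ _ => rfl)
        (by simpa [D1] using hc)).2.1
  filter_upwards [hS] with x hx mu hmu
  have := hmu (S x mu)
  simp only [D1, hx] at this
  ext i
  simpa using (Finset.sum_eq_zero_iff_of_nonneg fun i _ => mul_self_nonneg (mu i)).1 this i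
    (Finset.mem_univ i)

theorem scholtes_upper_neg {t x y d : ℝ} (ht : 0 < t) (hy : 0 ≤ y) (hxy : x * y = t) :
    y * d + x * -(1 + |y * d / x|) < 0 := by
  have hx : 0 < x := pos_of_mul_pos_left (hxy ▸ ht) hy
  have h1 : x * |y * d / x| = |y * d| := by
    rw [abs_div, abs_of_pos hx, mul_div_cancel₀ _ hx.ne']
  nlinarith [le_abs_self (y * d)]

theorem scholtes_lower_pos {t x y d : ℝ} (ht : 0 < t) (hy : 0 ≤ y) (hxy : x * y = -t) :
    0 < y * d + x * -(1 + |y * d / x|) := by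
  have := scholtes_upper_neg (x := -x) (d := -d) ht hy (by linarith)
  rw [mul_neg, neg_div_neg_eq] at this
  linarith

/-- Directions for `x` combined with a suitable direction for `y`, when the cardinality constraint
is inactive or some `y i` vanishes. -/
theorem exists_dy_of_slack {n κ : ℕ} {t : ℝ} (ht : 0 < t) {x y dx : Fin n → ℝ}
    (hy0 : ∀ i, 0 ≤ y i) (hcase : ∑ i, y i = (n : ℝ) - κ → ∃ i, y i = 0) :
    ∃ dy : Fin n → ℝ, (∀ i, y i = 0 → 0 < dy i) ∧ (∀ i, y i = 1 → dy i < 0) ∧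
      (∑ i, y i = (n : ℝ) - (κ : ℝ) → 0 < ∑ i, dy i) ∧
      (∀ i, x i * y i = t → y i * dx i + x i * dy i < 0) ∧
      (∀ i, x i * y i = -t → 0 < y i * dx i + x i * dy i) := by
  classical
  let M : Fin n → ℝ := fun i => 1 + |y i * dx i / x i|
  have hM : ∀ i, 0 < M i := fun i => by positivity
  have hMs : 0 ≤ ∑ i, M i := Finset.sum_nonneg fun i _ => (hM i).le
  refine ⟨fun i => if y i = 0 then 1 + ∑ j, M j else -M i, ?_, ?_, ?_, ?_, ?_⟩
  · intro i hi
    simp only [hi, if_true]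
    linarith
  · intro i hi
    simp [hi, hM i]
  · intro hs
    obtain ⟨k, hk⟩ := hcase hs
    have h1 : ∑ i, ((if i = k then 1 + ∑ j, M j else 0) - M i) ≤
        ∑ i, if y i = 0 then 1 + ∑ j, M j else -M i := by
      refine Finset.sum_le_sum fun i _ => ?_
      have := hM i
      split_ifs with h1 h2 h2
      · linarith
      · exact absurd (h1 ▸ hk) h2
      · linarith
      · linarith
    rw [Finset.sum_sub_distrib, Finset.sum_ite_eq' Finset.univ k] at h1
    simp only [Finset.mem_univ, if_true] at h1
    linarith
  · intro i hi
    have : y i ≠ 0 := by rintro h0; simp [h0] at hi; linarith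
    simpa only [this, if_false] using scholtes_upper_neg ht (hy0 i) hi
  · intro i hi
    have : y i ≠ 0 := by rintro h0; simp [h0] at hi; linarith
    simpa only [this, if_false] using scholtes_lower_pos ht (hy0 i) hi

theorem exists_dy_of_interior {n : ℕ} {t c C ε : ℝ} (ht : 0 < t) (hc : 0 < c) (hC : 0 ≤ C)
    (hε : 2 * n * C * ε ^ 2 ≤ c ^ 2)
    {x y d₀ w : Fin n → ℝ} {k : Fin n} {P : Fin n → Prop}
    (hy0 : ∀ i, 0 < y i) (hyk : y k ≠ 1) (hxk : |x k| ≤ ε)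
    (hxyt : ∀ i, |x i * y i| ≤ t)
    (hx : ∀ i, ¬ P i → c ≤ |x i|) (hd₀ : ∀ i, |d₀ i| ≤ C) (hw : ∀ i, |w i| ≤ C)
    (hd₀P : ∀ i, P i → d₀ i = 0) (hwP : ∀ i, P i → i ≠ k → w i = 0) (hPk : P k)
    (hwk : w k = if 0 < x k then -1 else 1) :
    ∃ s : ℝ, 0 ≤ s ∧ ∃ dy : Fin n → ℝ, (∀ i, y i = 1 → dy i < 0) ∧ 0 < ∑ i, dy i ∧
      (∀ i, x i * y i = t → y i * (d₀ + s • w) i + x i * dy i < 0) ∧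
      (∀ i, x i * y i = -t → 0 < y i * (d₀ + s • w) i + x i * dy i) := by
  classical
  let K : ℝ := 2 + 2 * n + 2 * (n * (t * C / c ^ 2))
  have hK : 0 ≤ K := by positivity
  let s : ℝ := (K + 1) * x k ^ 2 / t
  have hs : 0 ≤ s := by positivity
  let M : Fin n → ℝ := fun i => 1 + |y i * (d₀ + s • w) i / x i|
  have hM : ∀ i, 0 < M i := fun i => by positivity
  have hMb : ∀ i, i ≠ k → M i ≤ 1 + t * (C + s * C) / c ^ 2 := by
    intro i hik
    have hnn : 0 ≤ t * (C + s * C) / c ^ 2 := by positivity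
    by_cases hP : P i
    · have : (d₀ + s • w) i = 0 := by simp [hd₀P i hP, hwP i hP hik]
      simp only [M, this, mul_zero, zero_div, abs_zero]
      linarith
    · have hxi := hx i hP
      have hxi0 : 0 < |x i| := hc.trans_le hxi
      have hd : |(d₀ + s • w) i| ≤ C + s * C := by
        simp only [Pi.add_apply, Pi.smul_apply, smul_eq_mul]
        refine (abs_add_le _ _).trans (add_le_add (hd₀ i) ?_)
        rw [abs_mul, abs_of_nonneg hs]
        exact mul_le_mul_of_nonneg_left (hw i) hs
      have h1 : |y i * (d₀ + s • w) i / x i| = |x i * y i| * |(d₀ + s • w) i| / |x i| ^ 2 := by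
        rw [abs_div, abs_mul, abs_mul]
        field_simp
      simp only [M]
      rw [h1]
      gcongr
      exact hxyt i
  have hsum : ∑ i ∈ Finset.univ.erase k, M i < K := by
    have h1 : ∑ i ∈ Finset.univ.erase k, M i ≤ n * (1 + t * (C + s * C) / c ^ 2) := by
      refine (Finset.sum_le_card_nsmul _ _ _ fun i hi => hMb i (Finset.ne_of_mem_erase hi)).trans ?_
      rw [nsmul_eq_mul]
      gcongr
      simp
    have h2 : n * (t * (s * C) / c ^ 2) ≤ (K + 1) / 2 := by
      have hx2 : x k ^ 2 ≤ ε ^ 2 := by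
        rw [← sq_abs]
        gcongr
      have : t * (s * C) = (K + 1) * (x k ^ 2 * C) := by
        simp only [s]
        field_simp
      rw [this, ← mul_div_assoc, div_le_iff₀ (by positivity)]
      have h3 : 2 * n * C * x k ^ 2 ≤ c ^ 2 :=
        (mul_le_mul_of_nonneg_left hx2 (by positivity)).trans hε
      nlinarith
    have h3 : (n : ℝ) * (1 + t * (C + s * C) / c ^ 2) =
        n + n * (t * C / c ^ 2) + n * (t * (s * C) / c ^ 2) := by ring
    have h4 : (n : ℝ) + n * (t * C / c ^ 2) = K / 2 - 1 := by simp only [K]; ring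
    linarith
  refine ⟨s, hs, fun i => if i = k then K else -M i, ?_, ?_, ?_, ?_⟩
  · intro i hi
    have : i ≠ k := by rintro rfl; exact hyk hi
    simp [this, hM i]
  · rw [← Finset.add_sum_erase _ _ (Finset.mem_univ k)]
    have : ∑ i ∈ Finset.univ.erase k, (if i = k then K else -M i) =
        -∑ i ∈ Finset.univ.erase k, M i := by
      rw [← Finset.sum_neg_distrib]
      exact Finset.sum_congr rfl fun i hi => if_neg (Finset.ne_of_mem_erase hi)
    rw [this]
    simp only [if_true]
    linarith
  · intro i hi
    by_cases hik : i = k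
    · subst hik
      have hxp : 0 < x i := pos_of_mul_pos_left (hi ▸ ht) (hy0 i).le
      have : y i * s = (K + 1) * x i := by
        simp only [s, ← hi]
        have := hy0 i
        field_simp
      simp only [Pi.add_apply, Pi.smul_apply, smul_eq_mul, hd₀P i hPk, hwk, hxp, if_true]
      linarith
    · simpa only [hik, if_false] using scholtes_upper_neg ht (hy0 i).le hi
  · intro i hi
    by_cases hik : i = k
    · subst hik
      have hxp : x i < 0 := neg_of_mul_neg_left (by linarith) (hy0 i).le
      have : y i * s = -((K + 1) * x i) := by
        have ht' : t = -(x i * y i) := by linarith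
        simp only [s]
        rw [ht']
        have := hy0 i
        have := hxp.ne
        field_simp
      simp only [Pi.add_apply, Pi.smul_apply, smul_eq_mul, hd₀P i hPk, hwk, hxp.le.not_gt,
        if_false, if_true]
      linarith
    · simpa only [hik, if_false] using scholtes_lower_pos ht (hy0 i).le hi

/-- If every `y i` is positive and the cardinality constraint is active, some `i` with `xs i = 0`
has `y i < 1`. -/
theorem exists_lt_one_of_card_active {n κ : ℕ} (hκ0 : 0 < κ) {xs ys y : Fin n → ℝ}
    (hys1 : ∀ i, ys i ≤ 1) (hyss : (n : ℝ) - κ ≤ ∑ i, ys i) (hcomp : ∀ i, xs i * ys i = 0)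
    (hy0 : ∀ i, 0 < y i) (hs : ∑ i, y i = (n : ℝ) - κ) :
    ∃ k, xs k = 0 ∧ y k < 1 := by
  classical
  by_contra! hcon
  have hle : ∀ i ∈ Finset.univ, ys i ≤ y i := by
    intro i _
    by_cases hi : xs i = 0
    · exact (hys1 i).trans (hcon i hi)
    · rw [(mul_eq_zero.1 (hcomp i)).resolve_left hi]
      exact (hy0 i).le
  have hall : ∀ i, xs i = 0 := by
    intro i
    by_contra hi
    have := Finset.sum_lt_sum hle ⟨i, Finset.mem_univ i, by
      rw [(mul_eq_zero.1 (hcomp i)).resolve_left hi]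
      exact hy0 i⟩
    linarith
  have : ∑ _i : Fin n, (1 : ℝ) ≤ ∑ i, y i := Finset.sum_le_sum fun i _ => hcon i (hall i)
  have hκ : (0 : ℝ) < κ := by exact_mod_cast hκ0
  simp at this
  linarith

theorem stmt19
    {n m p : ℕ} (f : (Fin n → ℝ) → ℝ) (g : (Fin n → ℝ) → Fin m → ℝ)
    (h : (Fin n → ℝ) → Fin p → ℝ) (κ : ℕ)
    (hn : 0 < n) (hm : 0 < m) (hp : 0 < p) (hκ0 : 0 < κ) (hκn : κ < n)
    (hf : ContDiff ℝ 1 f) (hg : ∀ i, ContDiff ℝ 1 (fun x => g x i))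
    (hh : ∀ i, ContDiff ℝ 1 (fun x => h x i))
    (xs ys : Fin n → ℝ) (hZ : (xs, ys) ∈ ZSet g h κ) (hmfcq : CCMFCQ g h xs) :
    ∃ r > (0 : ℝ), ∃ T > (0 : ℝ), ∀ t : ℝ, 0 < t → t ≤ T →
      ∀ z ∈ ZReg g h κ t, dist z.1 xs < r → MFCQReg g h κ t z := by
  obtain ⟨-, -, -, hys1, hyss, hcomp⟩ := hZ
  choose B hB using hmfcq.eventually_exists_direction hg hh
  have hBk := fun k : Fin n => hB (Pi.single k 1)
  have hBk' := fun k : Fin n => hB (Pi.single k (-1))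
  obtain ⟨C, hC0, hCz, hCp, hCm⟩ : ∃ C, 0 ≤ C ∧ B 0 ≤ C ∧ (∀ k, B (Pi.single k 1) ≤ C) ∧
      ∀ k, B (Pi.single k (-1)) ≤ C := by
    have h1 := fun k => (le_abs_self _).trans (Finset.single_le_sum
      (f := fun k : Fin n => |B (Pi.single k 1)|) (fun i _ => abs_nonneg _) (Finset.mem_univ k))
    have h2 := fun k => (le_abs_self _).trans (Finset.single_le_sum
      (f := fun k : Fin n => |B (Pi.single k (-1))|) (fun i _ => abs_nonneg _) (Finset.mem_univ k))
    have h3 : 0 ≤ ∑ k : Fin n, |B (Pi.single k 1)| := Finset.sum_nonneg fun _ _ => abs_nonneg _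
    have h4 : 0 ≤ ∑ k : Fin n, |B (Pi.single k (-1))| := Finset.sum_nonneg fun _ _ => abs_nonneg _
    refine ⟨|B 0| + ∑ k : Fin n, |B (Pi.single k 1)| + ∑ k : Fin n, |B (Pi.single k (-1))|,
      by positivity, by linarith [le_abs_self (B 0)], fun k => ?_, fun k => ?_⟩
    · linarith [h1 k, abs_nonneg (B 0)]
    · linarith [h2 k, abs_nonneg (B 0)]
  obtain ⟨c, hc, hcx⟩ : ∃ c > (0 : ℝ), ∀ i, xs i ≠ 0 → c < |xs i| := by
    have : ∀ i, ∀ᶠ c in 𝓝[>] (0 : ℝ), xs i ≠ 0 → c < |xs i| := by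
      intro i
      by_cases hi : xs i = 0
      · simp [hi]
      · filter_upwards [nhdsWithin_le_nhds (Iio_mem_nhds (abs_pos.2 hi))] with c hc _ using hc
    exact ((eventually_all.2 this).and self_mem_nhdsWithin).exists.imp fun c hc => ⟨hc.2, hc.1⟩
  obtain ⟨ε, hε, hεC⟩ : ∃ ε > (0 : ℝ), 2 * n * C * ε ^ 2 ≤ c ^ 2 := by
    have : Tendsto (fun ε : ℝ => 2 * n * C * ε ^ 2) (𝓝[>] 0) (𝓝 0) := by
      have : Continuous fun ε : ℝ => 2 * n * C * ε ^ 2 := by fun_prop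
      simpa using (this.tendsto 0).mono_left nhdsWithin_le_nhds
    exact ((this.eventually (Iio_mem_nhds (by positivity : (0 : ℝ) < c ^ 2))).and
      self_mem_nhdsWithin).exists.imp fun ε hε => ⟨hε.2, hε.1.le⟩
  have hfar : ∀ᶠ x in 𝓝 xs, ∀ i, xs i ≠ 0 → c ≤ |x i| := by
    refine eventually_all.2 fun i => ?_
    by_cases hi : xs i = 0
    · simp [hi]
    · filter_upwards [continuousAt_const.eventually_lt
        (continuous_apply i).abs.continuousAt (hcx i hi)] with x hx _ using hx.le
  have hnear : ∀ᶠ x in 𝓝 xs, ∀ i, xs i = 0 → |x i| ≤ ε := by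
    refine eventually_all.2 fun i => ?_
    by_cases hi : xs i = 0
    · filter_upwards [(continuous_apply i).abs.continuousAt.eventually_lt
        (continuousAt_const (y := ε)) (by simpa [hi] using hε)] with x hx _ using hx.le
    · simp [hi]
  have hgact : ∀ᶠ x in 𝓝 xs, ∀ i, g x i = 0 → g xs i = 0 := by
    refine eventually_all.2 fun i => ?_
    by_cases hi : g xs i = 0
    · simp [hi]
    · filter_upwards [(hg i).continuous.continuousAt.eventually_ne hi] with x hx hx'
      exact absurd hx' hx
  obtain ⟨r, hr, hball⟩ := Metric.eventually_nhds_iff.1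
    ((hmfcq.eventually_equality_linearIndependent hh).and <| (hB 0).and <|
      (eventually_all.2 hBk).and <| (eventually_all.2 hBk').and <|
      hfar.and <| hnear.and hgact)
  refine ⟨r, hr, 1, one_pos, ?_⟩
  rintro t ht - ⟨x, y⟩ ⟨-, -, hy0, -, -, hup, hlo⟩ hdist
  dsimp only at hy0 hup hlo hdist
  obtain ⟨hLI, ⟨d₀, hd₀C, hd₀h, hd₀g, hd₀P⟩, hp, hm, hxfar, hxnear, hact⟩ := hball hdist
  refine ⟨hLI, ?_⟩
  by_cases hcase : ∑ i, y i = (n : ℝ) - κ → ∃ i, y i = 0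
  · obtain ⟨dy, hdy⟩ := exists_dy_of_slack (x := x) (dx := d₀) ht hy0 hcase
    exact ⟨d₀, dy, hd₀h, fun i hi => hd₀g i (hact i hi), hdy⟩
  push Not at hcase
  obtain ⟨hs, hyne⟩ := hcase
  have hypos : ∀ i, 0 < y i := fun i => (hy0 i).lt_of_ne' (hyne i)
  obtain ⟨k, hk, hyk⟩ := exists_lt_one_of_card_active hκ0 hys1 hyss hcomp hypos hs
  obtain ⟨w, hwC, hwh, hwg, hwP⟩ : ∃ w : Fin n → ℝ, ‖w‖ ≤ C ∧
      (∀ i, D1 (fun x' => h x' i) x w = 0) ∧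
      (∀ i, g xs i = 0 → D1 (fun x' => g x' i) x w < 0) ∧
      ∀ i, xs i = 0 → w i = (Pi.single k (if 0 < x k then -1 else 1) : Fin n → ℝ) i := by
    split_ifs
    · obtain ⟨w, hw, hw'⟩ := hm k
      exact ⟨w, hw.trans (hCm k), hw'⟩
    · obtain ⟨w, hw, hw'⟩ := hp k
      exact ⟨w, hw.trans (hCp k), hw'⟩
  obtain ⟨s, hs0, dy, hdy1, hdys, hdyu, hdyl⟩ := exists_dy_of_interior ht hc hC0 hεC
    (P := fun i => xs i = 0) hypos hyk.ne (hxnear k hk)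
    (fun i => abs_le.2 ⟨hlo i, hup i⟩) hxfar
    (fun i => (norm_le_pi_norm d₀ i).trans (hd₀C.trans hCz))
    (fun i => (norm_le_pi_norm w i).trans hwC)
    (fun i hi => by simpa using hd₀P i hi)
    (fun i hi hik => by simpa [hik] using hwP i hi) hk (by simpa using hwP k hk)
  refine ⟨d₀ + s • w, dy, fun i => ?_, fun i hi => ?_, fun i hi => absurd hi (hyne i), hdy1,
    fun _ => hdys, hdyu, hdyl⟩
  · have h1 := hd₀h i
    have h2 := hwh i
    simp only [D1] at h1 h2 ⊢
    simp [h1, h2]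
  · have h1 := hd₀g i (hact i hi)
    have h2 := hwg i (hact i hi)
    simp only [D1] at h1 h2 ⊢
    simp only [map_add, map_smul, smul_eq_mul]
    nlinarith
end
end
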